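/- arXiv:math/0111066 — 6 statements merged into one kernel-verified Lean document; each statement's English description precedes it below -/
import Mathlib

section
/- Let k be a field and n ≥ 2 an integer. Let V_{1,n} be the Leavitt k-algebra presented by generators x_1,…,x_n, y_1,…,y_n and relations x_i·y_j = δ_{ij}·1 for all i, j and y_1·x_1 + y_2·x_2 + ⋯ + y_n·x_n = 1 (the quotient of the free k-algebra k⟨x_1,…,x_n,y_1,…,y_n⟩ by these relations). Then V_{1,n} is a purely infinite simple ring. -/
universe u v w

/-- Murray–von Neumann equivalence of idempotents: `e ∼ f` iff there are `x ∈ eRf`,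
`y ∈ fRe` with `x*y = e` and `y*x = f`. -/
def IdemEquiv {R : Type*} [Ring R] (e f : R) : Prop :=
  ∃ x y : R, x = e * x * f ∧ y = f * y * e ∧ x * y = e ∧ y * x = f

/-- An idempotent `e` is infinite if `e = f + g` for orthogonal idempotents `f, g`
with `g ≠ 0` and `e ∼ f`. -/
def IsInfiniteIdem {R : Type*} [Ring R] (e : R) : Prop :=
  IsIdempotentElem e ∧ ∃ f g : R, IsIdempotentElem f ∧ IsIdempotentElem g ∧
    f * g = 0 ∧ g * f = 0 ∧ e = f + g ∧ g ≠ 0 ∧ IdemEquiv e f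

/-- A ring is purely infinite simple if it is simple and every nonzero right ideal
(submodule of `R` as a right module over itself, i.e. as an `Rᵐᵒᵖ`-module)
contains an infinite idempotent. -/
def PurelyInfiniteSimple (R : Type*) [Ring R] : Prop :=
  IsSimpleRing R ∧ ∀ I : Submodule Rᵐᵒᵖ R, I ≠ ⊥ → ∃ e ∈ I, IsInfiniteIdem e

/-- A module `M` is directly infinite if `M ≅ M ⊕ B` for some nonzero module `B`. -/
def DirectlyInfinite (R : Type u) (M : Type v) [Ring R] [AddCommGroup M] [Module R M] : Prop :=
  ∃ (B : Type v) (_ : AddCommGroup B) (_ : Module R B),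
    Nontrivial B ∧ Nonempty (M ≃ₗ[R] M × B)

open scoped BigOperators

/-- The defining relations of the Leavitt algebra `V_{1,n}`: on the free algebra on
generators `x_1, …, x_n` (encoded as `Sum.inl i`) and `y_1, …, y_n` (encoded as
`Sum.inr j`), the relations `x_i * y_j = δ_{ij} · 1` and `∑ i, y_i * x_i = 1`. -/
inductive LeavittRel (k : Type u) [Field k] (n : ℕ) :
    FreeAlgebra k (Fin n ⊕ Fin n) → FreeAlgebra k (Fin n ⊕ Fin n) → Prop
  | xy (i j : Fin n) : LeavittRel k n
      (FreeAlgebra.ι k (Sum.inl i) * FreeAlgebra.ι k (Sum.inr j))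
      (if i = j then 1 else 0)
  | sum : LeavittRel k n
      (∑ i : Fin n, FreeAlgebra.ι k (Sum.inr i) * FreeAlgebra.ι k (Sum.inl i)) 1

/-- The Leavitt algebra `V_{1,n}`. -/
abbrev LeavittAlg (k : Type u) [Field k] (n : ℕ) := RingQuot (LeavittRel k n)

namespace LeavittAux

section
variable {k : Type*} [Field k] {A : Type*} [Ring A] [Algebra k A] {n : ℕ}

def F (k : Type*) [Field k] {A : Type*} [Ring A] [Algebra k A] {n : ℕ} (y : Fin n → A) :
    ℕ → A → Prop
  | 0, a => ∃ c : k, a = algebraMap k A c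
  | d + 1, a => ∃ (c : k) (b : Fin n → A), (∀ i, F k y d (b i)) ∧
      a = algebraMap k A c + ∑ i, y i * b i

theorem F_const (y : Fin n → A) (d : ℕ) (c : k) : F k y d (algebraMap k A c) := by
  induction d generalizing c with
  | zero => exact ⟨c, rfl⟩
  | succ d ih =>
    refine ⟨c, fun _ => 0, fun i => ?_, by simp⟩
    simpa using ih 0

theorem F_zero (y : Fin n → A) (d : ℕ) : F k y d 0 := by
  simpa using F_const (k := k) y d 0

theorem F_add (y : Fin n → A) (d : ℕ) (a b : A) (ha : F k y d a) (hb : F k y d b) :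
    F k y d (a + b) := by
  induction d generalizing a b with
  | zero =>
    obtain ⟨c, rfl⟩ := ha
    obtain ⟨c', rfl⟩ := hb
    exact ⟨c + c', by simp⟩
  | succ d ih =>
    obtain ⟨c, f, hf, rfl⟩ := ha
    obtain ⟨c', g, hg, rfl⟩ := hb
    refine ⟨c + c', fun i => f i + g i, fun i => ih _ _ (hf i) (hg i), ?_⟩
    simp only [mul_add, Finset.sum_add_distrib, map_add]
    abel

theorem F_smul (y : Fin n → A) (d : ℕ) (r : k) (a : A) (ha : F k y d a) :
    F k y d (algebraMap k A r * a) := by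
  induction d generalizing a with
  | zero =>
    obtain ⟨c, rfl⟩ := ha
    exact ⟨r * c, by simp⟩
  | succ d ih =>
    obtain ⟨c, f, hf, rfl⟩ := ha
    refine ⟨r * c, fun i => algebraMap k A r * f i, fun i => ih _ (hf i), ?_⟩
    simp only [mul_add, Finset.mul_sum, map_mul, Algebra.left_comm]

theorem F_succ (y : Fin n → A) (d : ℕ) (a : A) (ha : F k y d a) : F k y (d + 1) a := by
  induction d generalizing a with
  | zero =>
    obtain ⟨c, rfl⟩ := ha
    exact F_const y _ c
  | succ d ih =>
    obtain ⟨c, f, hf, rfl⟩ := ha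
    exact ⟨c, f, fun i => ih _ (hf i), rfl⟩

theorem F_le (y : Fin n → A) {d e : ℕ} (h : d ≤ e) (a : A) (ha : F k y d a) : F k y e a := by
  induction h with
  | refl => exact ha
  | step _ ih => exact F_succ y _ _ ih

theorem F_left (y : Fin n → A) (d : ℕ) (j : Fin n) (a : A) (ha : F k y d a) :
    F k y (d + 1) (y j * a) := by
  refine ⟨0, fun i => if i = j then a else 0, fun i => ?_, by simp⟩
  dsimp only
  split_ifs
  · exact ha
  · exact F_zero y d

theorem F_right (y : Fin n → A) (d : ℕ) (j : Fin n) (a : A) (ha : F k y d a) :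
    F k y (d + 1) (a * y j) := by
  induction d generalizing a with
  | zero =>
    obtain ⟨c, rfl⟩ := ha
    rw [Algebra.commutes]
    exact F_left y _ _ _ (F_const y _ c)
  | succ d ih =>
    obtain ⟨c, f, hf, rfl⟩ := ha
    rw [add_mul, Algebra.commutes]
    refine F_add y _ _ _ (F_left y _ _ _ (F_const y _ c)) ?_
    refine ⟨0, fun i => f i * y j, fun i => ih _ (hf i), ?_⟩
    simp [Finset.sum_mul, mul_assoc]

def G (k : Type*) [Field k] {A : Type*} [Ring A] [Algebra k A] {n : ℕ} (y : Fin n → A) :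
    ℕ → A → Prop
  | 0, a => ∃ d, F k y d a
  | m + 1, a => ∀ i, G k y m (a * y i)

theorem G_succ (y : Fin n → A) (m : ℕ) (a : A) (ha : G k y m a) : G k y (m + 1) a := by
  induction m generalizing a with
  | zero =>
    obtain ⟨d, hd⟩ := ha
    exact fun i => ⟨d + 1, F_right y d i a hd⟩
  | succ m ih => exact fun i => ih _ (ha i)

theorem G_le (y : Fin n → A) {d e : ℕ} (h : d ≤ e) (a : A) (ha : G k y d a) : G k y e a := by
  induction h with
  | refl => exact ha
  | step _ ih => exact G_succ y _ _ ih

theorem G_add (y : Fin n → A) (m : ℕ) (a b : A) (ha : G k y m a) (hb : G k y m b) :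
    G k y m (a + b) := by
  induction m generalizing a b with
  | zero =>
    obtain ⟨d, hd⟩ := ha
    obtain ⟨e, he⟩ := hb
    exact ⟨max d e, F_add y _ _ _ (F_le y (le_max_left _ _) _ hd) (F_le y (le_max_right _ _) _ he)⟩
  | succ m ih =>
    intro i
    rw [add_mul]
    exact ih _ _ (ha i) (hb i)

theorem G_smul (y : Fin n → A) (m : ℕ) (r : k) (a : A) (ha : G k y m a) :
    G k y m (algebraMap k A r * a) := by
  induction m generalizing a with
  | zero =>
    obtain ⟨d, hd⟩ := ha
    exact ⟨d, F_smul y _ _ _ hd⟩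
  | succ m ih =>
    intro i
    rw [mul_assoc]
    exact ih _ (ha i)

theorem G_y (y : Fin n → A) (m : ℕ) (j : Fin n) (a : A) (ha : G k y m a) :
    G k y m (y j * a) := by
  induction m generalizing a with
  | zero =>
    obtain ⟨d, hd⟩ := ha
    exact ⟨d + 1, F_left y _ _ _ hd⟩
  | succ m ih =>
    intro i
    rw [mul_assoc]
    exact ih _ (ha i)

theorem x_mul_sum (x y : Fin n → A) (hxy : ∀ i j, x i * y j = if i = j then 1 else 0)
    (j : Fin n) (b : Fin n → A) : x j * ∑ i, y i * b i = b j := by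
  simp [Finset.mul_sum, ← mul_assoc, hxy]

theorem G_x (x y : Fin n → A) (hxy : ∀ i j, x i * y j = if i = j then 1 else 0)
    (m : ℕ) (j : Fin n) (a : A) (ha : G k y m a) :
    G k y (m + 1) (x j * a) := by
  induction m generalizing a with
  | zero =>
    obtain ⟨d, hd⟩ := ha
    obtain ⟨c, b, hb, rfl⟩ := F_succ y _ _ hd
    rw [mul_add, x_mul_sum x y hxy, ← Algebra.commutes]
    refine G_add y _ _ _ (G_smul y _ _ _ ?_) (G_succ y 0 _ ⟨d, hb j⟩)
    intro i
    rw [hxy]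
    split_ifs
    · exact ⟨0, 1, by simp⟩
    · exact ⟨0, 0, by simp⟩
  | succ m ih =>
    intro i
    rw [mul_assoc]
    exact ih _ (ha i)

theorem kill (x y : Fin n → A) (hxy : ∀ i j, x i * y j = if i = j then 1 else 0)
    (z o : Fin n) (hzo : o ≠ z) (d : ℕ) (b : A) (hb : F k y d b) (N M : ℕ) (hN : d ≤ N)
    (hM : N < M) : x o * x z ^ N * b * (y z ^ M * y o) = 0 := by
  have hone : ∀ K, x z ^ K * y z ^ K = 1 := by
    intro K
    induction K with
    | zero => simp
    | succ K ih =>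
      rw [pow_succ, pow_succ', mul_assoc, ← mul_assoc (x z) (y z), hxy]
      simpa using ih
  have key : ∀ (c : k) (N M : ℕ), N < M →
      x o * x z ^ N * algebraMap k A c * (y z ^ M * y o) = 0 := by
    intro c N M h
    obtain ⟨e, rfl⟩ := Nat.exists_eq_add_of_lt h
    rw [← Algebra.commutes, mul_assoc]
    have : x o * x z ^ N * (y z ^ (N + e + 1) * y o) = 0 := by
      rw [add_assoc, pow_add, mul_assoc, mul_assoc (y z ^ N), ← mul_assoc (x z ^ N), hone, one_mul,
        pow_succ', ← mul_assoc, ← mul_assoc, hxy]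
      simp [hzo]
    rw [this, mul_zero]
  induction d generalizing b N with
  | zero =>
    obtain ⟨c, rfl⟩ := hb
    exact key c N M hM
  | succ d ih =>
    obtain ⟨c, f, hf, rfl⟩ := hb
    obtain ⟨N, rfl⟩ : ∃ N', N = N' + 1 := ⟨N - 1, by omega⟩
    rw [mul_add, add_mul, key c _ _ hM, zero_add, pow_succ, ← mul_assoc (x o),
      mul_assoc _ (x z) (∑ i, _), x_mul_sum x y hxy]
    exact ih _ (hf z) N (by omega) (by omega)

theorem F_main (x y : Fin n → A) (hxy : ∀ i j, x i * y j = if i = j then 1 else 0)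
    (z o : Fin n) (hzo : o ≠ z) (d : ℕ) (a : A) (ha : F k y d a) (h0 : a ≠ 0) :
    ∃ p q, p * a * q = 1 := by
  have hone : ∀ K, x z ^ K * y z ^ K = 1 := by
    intro K
    induction K with
    | zero => simp
    | succ K ih =>
      rw [pow_succ, pow_succ', mul_assoc, ← mul_assoc (x z) (y z), hxy]
      simpa using ih
  induction d generalizing a with
  | zero =>
    obtain ⟨c, rfl⟩ := ha
    have hc : c ≠ 0 := by rintro rfl; simp at h0
    exact ⟨algebraMap k A c⁻¹, 1, by rw [mul_one, ← map_mul, inv_mul_cancel₀ hc, map_one]⟩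
  | succ d ih =>
    obtain ⟨c, f, hf, rfl⟩ := ha
    by_cases hc : c = 0
    · subst hc
      have : ∃ i, f i ≠ 0 := by
        by_contra! h
        simp [h] at h0
      obtain ⟨i, hi⟩ := this
      obtain ⟨p, q, hpq⟩ := ih _ (hf i) hi
      refine ⟨p * x i, q, ?_⟩
      rw [map_zero, zero_add, mul_assoc p, x_mul_sum x y hxy, hpq]
    · refine ⟨algebraMap k A c⁻¹ * (x o * x z ^ (d + 1)), y z ^ (d + 1) * y o, ?_⟩
      have h2 : x o * x z ^ (d + 1) * (∑ i, y i * f i) * (y z ^ (d + 1) * y o) = 0 := by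
        rw [pow_succ (x z), ← mul_assoc (x o), mul_assoc _ (x z) (∑ i, _), x_mul_sum x y hxy]
        exact kill x y hxy z o hzo d _ (hf z) d (d + 1) le_rfl (by omega)
      have h1 : x o * x z ^ (d + 1) * (y z ^ (d + 1) * y o) = 1 := by
        rw [mul_assoc, ← mul_assoc (x z ^ _), hone, one_mul, hxy]
        simp
      rw [mul_assoc (algebraMap k A c⁻¹), mul_assoc (algebraMap k A c⁻¹), mul_add, add_mul, h2,
        add_zero, ← Algebra.commutes, mul_assoc (algebraMap k A c), h1, mul_one, ← map_mul,
        inv_mul_cancel₀ hc, map_one]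

theorem G_main (x y : Fin n → A) (hxy : ∀ i j, x i * y j = if i = j then 1 else 0)
    (hs : ∑ i, y i * x i = 1)
    (z o : Fin n) (hzo : o ≠ z) (m : ℕ) (a : A) (ha : G k y m a) (h0 : a ≠ 0) :
    ∃ p q, p * a * q = 1 := by
  induction m generalizing a with
  | zero =>
    obtain ⟨d, hd⟩ := ha
    exact F_main x y hxy z o hzo d a hd h0
  | succ m ih =>
    have : ∃ i, a * y i ≠ 0 := by
      by_contra! h
      apply h0
      rw [← mul_one a, ← hs, Finset.mul_sum]
      simp [← mul_assoc, h]
    obtain ⟨i, hi⟩ := this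
    obtain ⟨p, q, hpq⟩ := ih _ (ha i) hi
    exact ⟨p, y i * q, by rw [← hpq]; simp only [mul_assoc]⟩

theorem pis (hnt : Nontrivial A) (x y : Fin n → A)
    (hxy : ∀ i j, x i * y j = if i = j then 1 else 0)
    (z o : Fin n) (hzo : o ≠ z) (H : ∀ a : A, a ≠ 0 → ∃ p q, p * a * q = 1) :
    PurelyInfiniteSimple A := by
  constructor
  · refine ⟨⟨fun I => ?_⟩⟩
    by_cases h : ∃ a ∈ I, a ≠ 0
    · right
      obtain ⟨a, ha, h0⟩ := h
      obtain ⟨p, q, hpq⟩ := H a h0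
      have : (1 : A) ∈ I := by
        rw [← hpq]
        exact I.mul_mem_right _ _ (I.mul_mem_left _ _ ha)
      rw [eq_top_iff]
      intro b _
      simpa using I.mul_mem_left b _ this
    · left
      push Not at h
      rw [eq_bot_iff]
      intro b hb
      rw [h b hb]
      exact zero_mem _
  · intro I hI
    obtain ⟨a, ha, h0⟩ := I.exists_mem_ne_zero_of_ne_bot hI
    obtain ⟨v, q, hpq⟩ := H a h0
    have hmem : a * q * v ∈ I := by
      have := I.smul_mem (MulOpposite.op (q * v)) ha
      simpa [mul_assoc] using this
    generalize hu : a * q = u at hmem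
    have hvu : v * u = 1 := by rw [← hu, ← mul_assoc, hpq]
    have hvu' : ∀ t, v * (u * t) = t := fun t => by rw [← mul_assoc, hvu, one_mul]
    have hzz : x z * y z = 1 := by simp [hxy]
    have hzz' : ∀ t, x z * (y z * t) = t := fun t => by rw [← mul_assoc, hzz, one_mul]
    refine ⟨u * v, hmem, ?_, u * (y z * (x z * v)), u * ((1 - y z * x z) * v), ?_, ?_, ?_, ?_, ?_,
      ?_, u * (x z * v), u * (y z * v), ?_, ?_, ?_, ?_⟩
    · simp only [IsIdempotentElem, mul_assoc, hvu']
    · simp only [IsIdempotentElem, mul_assoc, hvu', hzz']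
    · simp only [IsIdempotentElem, mul_assoc, hvu', hzz', sub_mul, mul_sub, one_mul, mul_one]
      abel
    · simp only [mul_assoc, hvu', hzz', sub_mul, mul_sub, one_mul, mul_one]
      abel
    · simp only [mul_assoc, hvu', hzz', sub_mul, mul_sub, one_mul, mul_one]
      abel
    · simp only [mul_assoc, sub_mul, mul_sub, one_mul]
      abel
    · intro hg
      have h1 : x o * (v * (u * ((1 - y z * x z) * v)) * u) * y o = 1 := by
        have hoo : x o * y o = 1 := by simp [hxy]
        have hzo' : x z * y o = 0 := by simp [hxy, hzo.symm]
        simp only [hvu', mul_assoc, hvu, sub_mul, mul_sub, one_mul, mul_one, hoo, hzo', mul_zero,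
          sub_zero]
      rw [hg] at h1
      simp at h1
    all_goals simp only [mul_assoc, hvu', hzz']

end

theorem nontriv (k : Type u) [Field k] (n : ℕ) (hn : 2 ≤ n) : Nontrivial (LeavittAlg k n) := by
  haveI : NeZero n := ⟨by omega⟩
  let φ : ℕ ≃ ℕ × Fin n := Nat.divModEquiv n
  let X : Fin n → Module.End k (ℕ → k) := fun i =>
    { toFun := fun f m => f (φ.symm (m, i))
      map_add' := fun _ _ => rfl
      map_smul' := fun _ _ => rfl }
  let Y : Fin n → Module.End k (ℕ → k) := fun i =>
    { toFun := fun f m => if (φ m).2 = i then f (φ m).1 else 0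
      map_add' := fun f g => by
        funext m
        by_cases h : (φ m).2 = i <;> simp [h]
      map_smul' := fun c f => by
        funext m
        by_cases h : (φ m).2 = i <;> simp [h] }
  let ψ : FreeAlgebra k (Fin n ⊕ Fin n) →ₐ[k] Module.End k (ℕ → k) :=
    FreeAlgebra.lift k (Sum.elim X Y)
  have hψ : ∀ ⦃a b⦄, LeavittRel k n a b → ψ a = ψ b := by
    intro a b h
    cases h with
    | xy i j =>
      apply LinearMap.ext
      intro f
      funext m
      by_cases h : i = j <;> simp [ψ, X, Y, h]
    | sum =>
      apply LinearMap.ext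
      intro f
      funext m
      simp only [ψ, map_sum, map_mul, FreeAlgebra.lift_ι_apply, Sum.elim_inl, Sum.elim_inr,
        LinearMap.sum_apply, Finset.sum_apply, map_one]
      simp [X, Y]
  exact (RingQuot.liftAlgHom k ⟨ψ, hψ⟩).toRingHom.domain_nontrivial

end LeavittAux

/-- For `n ≥ 2`, the Leavitt algebra `V_{1,n}` is a purely infinite
simple ring. -/
theorem stmt13 (k : Type u) [Field k] (n : ℕ) (hn : 2 ≤ n) :
    PurelyInfiniteSimple (LeavittAlg k n) := by
  let π := RingQuot.mkAlgHom k (LeavittRel k n)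
  let x : Fin n → LeavittAlg k n := fun i => π (FreeAlgebra.ι k (Sum.inl i))
  let y : Fin n → LeavittAlg k n := fun i => π (FreeAlgebra.ι k (Sum.inr i))
  have hxy : ∀ i j, x i * y j = if i = j then 1 else 0 := by
    intro i j
    have := RingQuot.mkAlgHom_rel k (LeavittRel.xy (k := k) i j)
    rw [map_mul] at this
    refine this.trans ?_
    split_ifs <;> simp
  have hs : ∑ i, y i * x i = 1 := by
    have := RingQuot.mkAlgHom_rel k (LeavittRel.sum (k := k) (n := n))
    simpa only [map_sum, map_mul, map_one] using this
  have hzo : (⟨1, by omega⟩ : Fin n) ≠ ⟨0, by omega⟩ := by simp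
  refine LeavittAux.pis (LeavittAux.nontriv k n hn) x y hxy _ _ hzo ?_
  intro a h0
  have key : ∀ w : FreeAlgebra k (Fin n ⊕ Fin n), ∀ b : LeavittAlg k n,
      (∃ m, LeavittAux.G k y m b) → ∃ m, LeavittAux.G k y m (π w * b) := by
    intro w
    induction w using FreeAlgebra.induction with
    | grade0 r =>
      rintro b ⟨m, hm⟩
      rw [AlgHom.commutes]
      exact ⟨m, LeavittAux.G_smul y m r b hm⟩
    | grade1 g =>
      rintro b ⟨m, hm⟩
      cases g with
      | inl i => exact ⟨m + 1, LeavittAux.G_x x y hxy m i b hm⟩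
      | inr i => exact ⟨m, LeavittAux.G_y y m i b hm⟩
    | mul u v hu hv =>
      intro b hb
      rw [map_mul, mul_assoc]
      exact hu _ (hv _ hb)
    | add u v hu hv =>
      intro b hb
      obtain ⟨m, hm⟩ := hu b hb
      obtain ⟨m', hm'⟩ := hv b hb
      rw [map_add, add_mul]
      exact ⟨max m m', LeavittAux.G_add y _ _ _ (LeavittAux.G_le y (le_max_left _ _) _ hm)
        (LeavittAux.G_le y (le_max_right _ _) _ hm')⟩
  obtain ⟨w, rfl⟩ := RingQuot.mkAlgHom_surjective k (LeavittRel k n) a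
  obtain ⟨m, hm⟩ := key w 1 ⟨0, 0, 1, by simp⟩
  rw [mul_one] at hm
  exact LeavittAux.G_main x y hxy hs _ _ hzo m _ hm h0
end

section
/- Let k be a field and let U_∞ be the k-algebra presented by generators x_i, y_i for i ∈ ℕ and relations x_i·y_j = δ_{ij}·1 for all i, j ∈ ℕ (the quotient of the free k-algebra on the countably many generators x_0, x_1, …, y_0, y_1, … by these relations). Then U_∞ is a purely infinite simple ring. -/
universe u v w

/-- The defining relations of `U_∞`: on the free algebra on countably many generators
`x_i` (encoded as `Sum.inl i`) and `y_j` (encoded as `Sum.inr j`), `i, j ∈ ℕ`, the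
relations `x_i * y_j = δ_{ij} · 1`. -/
inductive UInfRel (k : Type u) [Field k] :
    FreeAlgebra k (ℕ ⊕ ℕ) → FreeAlgebra k (ℕ ⊕ ℕ) → Prop
  | xy (i j : ℕ) : UInfRel k
      (FreeAlgebra.ι k (Sum.inl i) * FreeAlgebra.ι k (Sum.inr j))
      (if i = j then 1 else 0)

namespace UInf

variable {k : Type u} [Field k] {R : Type v} [Ring R] [Algebra k R]

/-- ordered product of y's -/
def Y (y : ℕ → R) : List ℕ → R
  | [] => 1
  | i :: l => y i * Y y l

/-- reversed product of x's -/
def X (x : ℕ → R) : List ℕ → R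
  | [] => 1
  | i :: l => X x l * x i

lemma Y_append (y : ℕ → R) (l m : List ℕ) : Y y (l ++ m) = Y y l * Y y m := by
  induction l with
  | nil => simp [Y]
  | cons i l ih => simp [Y, ih, mul_assoc]

lemma X_append (x : ℕ → R) (l m : List ℕ) : X x (l ++ m) = X x m * X x l := by
  induction l with
  | nil => simp [X]
  | cons i l ih => simp [X, ih, mul_assoc]

lemma step {x y : ℕ → R} (h : ∀ i j, x i * y j = if i = j then 1 else 0)
    (i j : ℕ) (l m : List ℕ) :
    X x (i :: l) * Y y (j :: m) = if i = j then X x l * Y y m else 0 := by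
  have : X x (i :: l) * Y y (j :: m) = X x l * (x i * y j) * Y y m := by
    simp [X, Y, mul_assoc]
  rw [this, h]
  split_ifs <;> simp

lemma lemA {x y : ℕ → R} (h : ∀ i j, x i * y j = if i = j then 1 else 0) (N : ℕ) :
    ∀ (a b : List ℕ), N ∉ a → N ∉ b →
      X x (a ++ [N]) * Y y (b ++ [N]) = if a = b then 1 else 0
  | [], [], _, _ => by simp [X, Y, h]
  | i :: a, [], ha, _ => by
    have : i ≠ N := by rintro rfl; simp at ha
    rw [List.nil_append, List.cons_append, step h]; simp [this]
  | [], j :: b, _, hb => by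
    have : N ≠ j := by rintro rfl; simp at hb
    rw [List.nil_append, List.cons_append, step h]; simp [this]
  | i :: a, j :: b, ha, hb => by
    rw [List.cons_append, List.cons_append, step h,
      lemA h N a b (fun hh => ha (by simp [hh])) (fun hh => hb (by simp [hh]))]
    by_cases h1 : i = j <;> by_cases h2 : a = b <;> simp [h1, h2]

lemma lemB {x y : ℕ → R} (h : ∀ i j, x i * y j = if i = j then 1 else 0) (N : ℕ) :
    ∀ (a b : List ℕ), N ∉ a → b.length ≤ a.length →
      X x a * Y y (b ++ [N]) = if a = b then y N else 0
  | [], [], _, _ => by simp [X, Y]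
  | i :: a, [], ha, _ => by
    have : i ≠ N := by rintro rfl; simp at ha
    rw [List.nil_append, step h]; simp [this]
  | [], j :: b, _, hb => by simp at hb
  | i :: a, j :: b, ha, hb => by
    rw [List.cons_append, step h,
      lemB h N a b (fun hh => ha (by simp [hh])) (by simpa using hb)]
    by_cases h1 : i = j <;> by_cases h2 : a = b <;> simp [h1, h2]

lemma key {x y : ℕ → R} (h : ∀ i j, x i * y j = if i = j then 1 else 0)
    (hs : ∀ r : R, r ∈ Submodule.span k
      (Set.range fun p : List ℕ × List ℕ => Y y p.1 * X x p.2))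
    (a : R) (ha : a ≠ 0) : ∃ p q : R, p * a * q = 1 := by
  obtain ⟨c, hc⟩ := (Finsupp.mem_span_range_iff_exists_finsupp).1 (hs a)
  have hne : c.support.Nonempty := by
    rw [Finsupp.support_nonempty_iff]
    rintro rfl
    exact ha (by simpa using hc.symm)
  obtain ⟨⟨α, β⟩, hm, hmin⟩ := Finset.exists_min_image c.support (fun p => p.2.length) hne
  obtain ⟨N, hN⟩ := Infinite.exists_notMem_finset
    (c.support.biUnion fun p => (p.1 ++ p.2).toFinset)
  have hN' : ∀ p ∈ c.support, N ∉ p.1 ∧ N ∉ p.2 := by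
    intro p hp
    constructor <;> intro hh <;> exact hN (Finset.mem_biUnion.2 ⟨p, hp, by simp [hh]⟩)
  have hcα : c (α, β) ≠ 0 := by simpa using hm
  refine ⟨(c (α, β))⁻¹ • X x (α ++ [N]), Y y (β ++ [N]), ?_⟩
  have hterm : ∀ p ∈ c.support, X x (α ++ [N]) * (Y y p.1 * X x p.2) * Y y (β ++ [N])
      = if p = (α, β) then 1 else 0 := by
    rintro ⟨α', β'⟩ hp
    have e1 : X x (α ++ [N]) * (Y y α' * X x β') * Y y (β ++ [N])
      = X x (α ++ [N]) * (Y y α' * (X x β' * Y y (β ++ [N]))) := by simp only [mul_assoc]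
    rw [e1, lemB h N β' β (hN' _ hp).2 (hmin _ hp)]
    by_cases hb : β' = β
    · have := lemA h N α α' (hN' _ hm).1 (hN' _ hp).1
      rw [Y_append y α' [N]] at this
      simp only [Y, mul_one] at this
      rw [if_pos hb, this]
      simp [hb, eq_comm]
    · simp [hb]
  rw [← hc, Finsupp.sum, Finset.mul_sum, Finset.sum_mul, Finset.sum_eq_single (α, β)]
  · have := hterm _ hm
    simp only [if_true] at this
    rw [mul_smul_comm, smul_mul_assoc, smul_mul_assoc, smul_mul_assoc, this, smul_smul,
      mul_inv_cancel₀ hcα, one_smul]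
  · intro p hp hpn
    have := hterm _ hp
    rw [if_neg hpn] at this
    rw [mul_smul_comm, smul_mul_assoc, smul_mul_assoc, smul_mul_assoc, this, smul_zero, smul_zero]
  · intro hh; exact absurd hm hh

lemma pis [Nontrivial R] {x y : ℕ → R} (h : ∀ i j, x i * y j = if i = j then 1 else 0)
    (hk : ∀ a : R, a ≠ 0 → ∃ p q : R, p * a * q = 1) : PurelyInfiniteSimple R := by
  have h00 : x 0 * y 0 = 1 := by simp [h]
  have hg0 : (1 : R) - y 0 * x 0 ≠ 0 := by
    intro h0
    have h1 : x 1 * (1 - y 0 * x 0) * y 1 = 1 := by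
      rw [mul_sub, ← mul_assoc, h 1 0]; simp [h]
    rw [h0] at h1
    simp at h1
  constructor
  · refine isSimpleRing_iff_isTwoSided_imp.2 ⟨inferInstance, ?_⟩
    intro I hI
    by_cases hb : I = ⊥
    · exact Or.inl hb
    · right
      obtain ⟨a, haI, ha⟩ := Submodule.exists_mem_ne_zero_of_ne_bot hb
      obtain ⟨p, q, hpq⟩ := hk a ha
      rw [Ideal.eq_top_iff_one, ← hpq]
      exact I.mul_mem_right _ (I.mul_mem_left _ haI)
  · intro I hI
    obtain ⟨a, haI, ha⟩ := Submodule.exists_mem_ne_zero_of_ne_bot hI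
    obtain ⟨p, q, hpq⟩ := hk a ha
    have hmem : a * q * p ∈ I := by
      have := I.smul_mem (MulOpposite.op (q * p)) haI
      simpa [mul_assoc] using this
    set b := a * q with hb
    have hpb : p * b = 1 := by rw [hb, ← mul_assoc, hpq]
    have conj : ∀ r s : R, (b * r * p) * (b * s * p) = b * (r * s) * p := by
      intro r s
      calc (b * r * p) * (b * s * p) = b * r * (p * b) * s * p := by simp only [mul_assoc]
        _ = _ := by rw [hpb]; simp only [mul_assoc, mul_one]; 
    have e1 : b * p = b * 1 * p := by simp
    have c4 : (y 0 * x 0) * (y 0 * x 0) = y 0 * x 0 := by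
      rw [mul_assoc, ← mul_assoc (x 0), h00, one_mul]
    refine ⟨b * p, hmem, ?_, b * (y 0 * x 0) * p, b * (1 - y 0 * x 0) * p, ?_, ?_, ?_, ?_, ?_, ?_,
      b * x 0 * p, b * y 0 * p, ?_, ?_, ?_, ?_⟩
    · rw [IsIdempotentElem, e1, conj, mul_one]
    · rw [IsIdempotentElem, conj, c4]
    · rw [IsIdempotentElem, conj]; congr 2; rw [mul_sub, sub_mul, sub_mul, c4]; simp
    · rw [conj, mul_sub, c4]; simp
    · rw [conj, sub_mul, c4]; simp
    · rw [← add_mul, ← mul_add]; simp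
    · intro h0
      apply hg0
      calc 1 - y 0 * x 0 = (p * b) * (1 - y 0 * x 0) * (p * b) := by rw [hpb]; simp
        _ = p * (b * (1 - y 0 * x 0) * p) * b := by simp only [mul_assoc]
        _ = 0 := by rw [h0]; simp
    · rw [e1, conj, conj, one_mul, ← mul_assoc (x 0), h00, one_mul]
    · rw [e1, conj, conj, mul_one, mul_assoc (y 0), h00, mul_one]
    · rw [conj, h00, mul_one]
    · rw [conj]

/-- concrete x -/
def xop (k : Type u) [Field k] (i : ℕ) : Module.End k (ℕ → k) where
  toFun f := fun n => f (Nat.pair i n)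
  map_add' _ _ := rfl
  map_smul' _ _ := rfl

/-- concrete y -/
def yop (k : Type u) [Field k] (j : ℕ) : Module.End k (ℕ → k) where
  toFun f := fun n => if (Nat.unpair n).1 = j then f (Nat.unpair n).2 else 0
  map_add' f g := by ext n; simp only [Pi.add_apply]; split_ifs <;> simp
  map_smul' c f := by ext n; simp

end UInf

open UInf in
/-- The algebra `U_∞` presented by generators `x_i, y_i (i ∈ ℕ)` and
relations `x_i y_j = δ_{ij} · 1` is a purely infinite simple ring. -/
theorem stmt14 (k : Type u) [Field k] :
    PurelyInfiniteSimple (RingQuot (UInfRel k)) := by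
  let π := RingQuot.mkAlgHom k (UInfRel k)
  let x : ℕ → RingQuot (UInfRel k) := fun i => π (FreeAlgebra.ι k (Sum.inl i))
  let y : ℕ → RingQuot (UInfRel k) := fun i => π (FreeAlgebra.ι k (Sum.inr i))
  have h : ∀ i j, x i * y j = if i = j then 1 else 0 := by
    intro i j
    have := RingQuot.mkAlgHom_rel k (UInfRel.xy (k := k) i j)
    rw [map_mul] at this
    refine this.trans ?_
    split_ifs <;> simp
  have : Nontrivial (RingQuot (UInfRel k)) := by
    let φ : FreeAlgebra k (ℕ ⊕ ℕ) →ₐ[k] Module.End k (ℕ → k) :=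
      FreeAlgebra.lift k (Sum.elim (xop k) (yop k))
    have hφ : ∀ ⦃a b⦄, UInfRel k a b → φ a = φ b := by
      rintro _ _ ⟨i, j⟩
      have : φ (FreeAlgebra.ι k (Sum.inl i) * FreeAlgebra.ι k (Sum.inr j))
          = xop k i * yop k j := by simp [φ]
      rw [this]
      refine LinearMap.ext fun f => funext fun n => ?_
      by_cases hij : i = j <;> simp [xop, yop, hij]
    exact (RingQuot.liftAlgHom k ⟨φ, hφ⟩).toRingHom.domain_nontrivial
  refine pis h (key (k := k) h ?_)
  set S := Submodule.span k (Set.range fun p : List ℕ × List ℕ => Y y p.1 * X x p.2) with hS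
  have gen : ∀ p : List ℕ × List ℕ, Y y p.1 * X x p.2 ∈ S :=
    fun p => Submodule.subset_span ⟨p, rfl⟩
  have lift : ∀ r : RingQuot (UInfRel k), (∀ p : List ℕ × List ℕ, r * (Y y p.1 * X x p.2) ∈ S) →
      ∀ s ∈ S, r * s ∈ S := by
    intro r hr s hs
    have : S ≤ S.comap (LinearMap.mulLeft k r) := by
      rw [hS, Submodule.span_le]
      rintro _ ⟨p, rfl⟩
      exact hr p
    exact this hs
  have main : ∀ w : FreeAlgebra k (ℕ ⊕ ℕ), ∀ s ∈ S, π w * s ∈ S := by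
    intro w
    induction w using FreeAlgebra.induction with
    | grade0 c =>
      intro s hs
      rw [AlgHom.commutes, ← Algebra.smul_def]
      exact S.smul_mem _ hs
    | grade1 g =>
      rcases g with i | i
      · apply lift
        rintro ⟨α, β⟩
        change x i * _ ∈ S
        rcases α with _ | ⟨j, α⟩
        · have := gen ([], β ++ [i])
          rw [X_append] at this
          simpa [Y, X] using this
        · have e : x i * (Y y (j :: α) * X x β) = (x i * y j) * (Y y α * X x β) := by
            simp [Y, mul_assoc]
          simp only [e, h]
          split_ifs
          · simpa using gen (α, β)
          · simp
      · apply lift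
        rintro ⟨α, β⟩
        change y i * _ ∈ S
        have := gen (i :: α, β)
        simpa [Y, mul_assoc] using this
    | mul a b ha hb =>
      intro s hs
      rw [map_mul, mul_assoc]
      exact ha _ (hb _ hs)
    | add a b ha hb =>
      intro s hs
      rw [map_add, add_mul]
      exact S.add_mem (ha _ hs) (hb _ hs)
  intro r
  obtain ⟨w, rfl⟩ := RingQuot.mkAlgHom_surjective k (UInfRel k) r
  have := main w 1 (by simpa [X, Y] using gen ([], []))
  simpa using this
end

section
/- For every field k and every integer n ≥ 1 there exists a k-algebra T such that: (i) T is von Neumann regular; (ii) T is a purely infinite simple ring; (iii) every finitely generated projective right T-module is free; and (iv) for all integers ℓ, m ≥ 1, the free right T-modules T^ℓ and T^m are isomorphic if and only if ℓ ≡ m (mod n). -/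
universe u v w

section Diag
open Matrix

def QP (n : ℕ) {T : Type u} [Ring T] {ι κ : Type} [Fintype ι] [Fintype κ] [DecidableEq ι]
    [DecidableEq κ] (A : Matrix ι κ T) : Prop :=
  (∃ (ρ : Type) (_ : Fintype ρ) (_ : DecidableEq ρ) (U : Matrix κ ρ T) (W : Matrix ρ ι T),
    W * A * U = 1 ∧ A * U * W * A = A) ∧
  (∀ N : Matrix κ ι T, A * N = 1 → N * A = 1 → Fintype.card ι ≡ Fintype.card κ [MOD n])

variable {n : ℕ} {T : Type u} [Ring T]

lemma QP.equiv {ι κ ι' κ' : Type} [Fintype ι] [Fintype κ] [DecidableEq ι]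
    [DecidableEq κ] [Fintype ι'] [Fintype κ'] [DecidableEq ι'] [DecidableEq κ']
    {B : Matrix ι' κ' T} (hB : QP n B) (A : Matrix ι κ T)
    (P : Matrix ι ι' T) (P' : Matrix ι' ι T) (S : Matrix κ' κ T) (S' : Matrix κ κ' T)
    (h1 : P * P' = 1) (h2 : P' * P = 1) (h3 : S * S' = 1) (h4 : S' * S = 1)
    (hA : A = P * B * S) (c1 : Fintype.card ι ≡ Fintype.card ι' [MOD n])
    (c2 : Fintype.card κ ≡ Fintype.card κ' [MOD n]) : QP n A := by
  obtain ⟨⟨ρ, _, _, U, W, hW, hU⟩, hN⟩ := hB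
  subst hA
  refine ⟨⟨ρ, inferInstance, inferInstance, S' * U, W * P', ?_, ?_⟩, ?_⟩
  · calc W * P' * (P * B * S) * (S' * U) = W * (P' * P) * B * (S * S') * U := by
          simp only [Matrix.mul_assoc]
      _ = 1 := by rw [h2, h3, Matrix.mul_one, Matrix.mul_one, hW]
  · calc P * B * S * (S' * U) * (W * P') * (P * B * S)
        = P * (B * (S * S') * U * W * (P' * P) * B) * S := by simp only [Matrix.mul_assoc]
      _ = _ := by rw [h2, h3, Matrix.mul_one, Matrix.mul_one, hU]
  · intro N e1 e2
    refine c1.trans ((hN (S * N * P) ?_ ?_).trans c2.symm)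
    · calc B * (S * N * P) = (P' * P) * B * (S * N * P) := by rw [h2, Matrix.one_mul]
        _ = P' * (P * B * S * N) * P := by simp only [Matrix.mul_assoc]
        _ = 1 := by rw [e1, Matrix.mul_one, h2]
    · calc S * N * P * B = S * N * P * B * (S * S') := by rw [h3, Matrix.mul_one]
        _ = S * (N * (P * B * S)) * S' := by simp only [Matrix.mul_assoc]
        _ = 1 := by rw [e2, Matrix.mul_one, h3]

lemma QP.zero [Nontrivial T] {ι κ : Type} [Fintype ι] [Fintype κ] [DecidableEq ι]
    [DecidableEq κ] : QP n (0 : Matrix ι κ T) := by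
  refine ⟨⟨Empty, inferInstance, inferInstance, 0, 0, ?_, by simp⟩, ?_⟩
  · ext i; exact i.elim
  · intro N h1 h2
    have a1 : IsEmpty ι := by
      by_contra h
      rw [not_isEmpty_iff] at h
      obtain ⟨i⟩ := h
      have := congrFun (congrFun h1 i) i
      simp at this
    have a2 : IsEmpty κ := by
      by_contra h
      rw [not_isEmpty_iff] at h
      obtain ⟨i⟩ := h
      have := congrFun (congrFun h2 i) i
      simp at this
    simp [Fintype.card_eq_zero, Nat.ModEq]

lemma QP.block {ι κ : Type} [Fintype ι] [Fintype κ] [DecidableEq ι]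
    [DecidableEq κ] {B : Matrix ι κ T} (hB : QP n B) :
    QP n (fromBlocks (1 : Matrix Unit Unit T) 0 0 B) := by
  obtain ⟨⟨ρ, _, _, U, W, hW, hU⟩, hN⟩ := hB
  refine ⟨⟨Unit ⊕ ρ, inferInstance, inferInstance, fromBlocks 1 0 0 U, fromBlocks 1 0 0 W,
    ?_, ?_⟩, ?_⟩
  · simp [fromBlocks_multiply, hW]
  · simp [fromBlocks_multiply, hU]
  · intro N h1 h2
    rw [← fromBlocks_toBlocks N, fromBlocks_multiply, ← fromBlocks_one, fromBlocks_inj] at h1 h2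
    have := hN N.toBlocks₂₂ (by simpa using h1.2.2.2) (by simpa using h2.2.2.2)
    simp only [Fintype.card_sum]
    exact this.add_left _

lemma QP.submatrix {ι κ ι' κ' : Type} [Fintype ι] [Fintype κ] [DecidableEq ι]
    [DecidableEq κ] [Fintype ι'] [Fintype κ'] [DecidableEq ι'] [DecidableEq κ']
    (A : Matrix ι κ T) (e : ι' ≃ ι) (f : κ' ≃ κ) (h : QP n (A.submatrix e f)) : QP n A := by
  refine h.equiv A ((1 : Matrix ι ι T).submatrix id e) ((1 : Matrix ι ι T).submatrix e id)
    ((1 : Matrix κ κ T).submatrix f id) ((1 : Matrix κ κ T).submatrix id f) ?_ ?_ ?_ ?_ ?_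
    (by rw [Fintype.card_congr e]) (by rw [Fintype.card_congr f])
  · rw [Matrix.submatrix_mul_equiv]; simp
  · rw [← Matrix.submatrix_mul _ _ _ _ _ Function.bijective_id]; simp
  · rw [← Matrix.submatrix_mul _ _ _ _ _ Function.bijective_id]; simp
  · rw [Matrix.submatrix_mul_equiv]; simp
  · rw [Matrix.submatrix_mul_equiv, Matrix.submatrix_mul_equiv]; simp

lemma QP.elim {ι κ : Type} [Fintype ι] [Fintype κ] [DecidableEq ι]
    [DecidableEq κ] (a a' : Matrix Unit Unit T) (b : Matrix Unit κ T) (c : Matrix ι Unit T)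
    (D : Matrix ι κ T) (h1 : a * a' = 1) (h2 : a' * a = 1)
    (h : QP n (D - c * a' * b)) : QP n (fromBlocks a b c D) := by
  refine h.block.equiv _ (fromBlocks 1 0 (c * a') 1) (fromBlocks 1 0 (-(c * a')) 1)
    (fromBlocks a b 0 1) (fromBlocks a' (-(a' * b)) 0 1) ?_ ?_ ?_ ?_ ?_ rfl rfl
  · simp [fromBlocks_multiply]
  · simp [fromBlocks_multiply]
  · simp [fromBlocks_multiply, h1, ← Matrix.mul_assoc]
  · simp [fromBlocks_multiply, h2]
  · simp [fromBlocks_multiply, Matrix.mul_assoc, h2]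

def XM {d : ℕ} (κ : Type) [DecidableEq κ] (x : Fin d → T) : Matrix κ (κ × Fin d) T :=
  fun i p => if i = p.1 then x p.2 else 0

def YM {d : ℕ} (κ : Type) [DecidableEq κ] (y : Fin d → T) : Matrix (κ × Fin d) κ T :=
  fun p i => if p.1 = i then y p.2 else 0

lemma XM_mul_YM {d : ℕ} {κ : Type} [DecidableEq κ] [Fintype κ] {x y : Fin d → T}
    (h : ∑ i, x i * y i = 1) : XM κ x * YM κ y = 1 := by
  ext i j
  simp only [Matrix.mul_apply, XM, YM, Fintype.sum_prod_type, Matrix.one_apply]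
  simp [h]

lemma YM_mul_XM {d : ℕ} {κ : Type} [DecidableEq κ] [Fintype κ] {x y : Fin d → T}
    (h : ∀ i j, y i * x j = if i = j then 1 else 0) : YM κ y * XM κ x = 1 := by
  ext ⟨i, c⟩ ⟨j, c'⟩
  simp only [Matrix.mul_apply, XM, YM, Matrix.one_apply]
  simp [h, Prod.ext_iff, ite_and]

lemma YM_mul_apply {d : ℕ} {κ ι : Type} [DecidableEq κ] [Fintype κ] (y : Fin d → T)
    (A : Matrix κ ι T) (p : κ × Fin d) (j : ι) : (YM κ y * A) p j = y p.2 * A p.1 j := by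
  simp [Matrix.mul_apply, YM]

lemma mul_XM_apply {d : ℕ} {κ ι : Type} [DecidableEq κ] [Fintype κ] (x : Fin d → T)
    (A : Matrix ι κ T) (i : ι) (p : κ × Fin d) : (A * XM κ x) i p = A i p.1 * x p.2 := by
  simp [Matrix.mul_apply, XM]

lemma card_mod (κ : Type) [Fintype κ] :
    Fintype.card κ ≡ Fintype.card (κ × Fin (n + 1)) [MOD n] := by
  simp [Nat.ModEq, mul_add]

structure Setup (n : ℕ) (T : Type u) [Ring T] where
  R : Subring T
  x : Fin (n + 1) → T
  y : Fin (n + 1) → T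
  hyx : ∀ i j, y i * x j = if i = j then 1 else 0
  hxy : ∑ i, x i * y i = 1
  F : ℕ → Set T
  hF0 : F 0 ⊆ R
  hFs : ∀ N, ∀ a ∈ F (N + 1), ∀ i, a * x i ∈ F N
  hFm : Monotone F
  hF : ∀ a, ∃ N, a ∈ F N
  O : ℕ → T → Prop
  hO0 : ∀ a ∈ R, O 0 a → ∃ b ∈ R, a * b = 1 ∧ b * a = 1
  hO : ∀ a ∈ R, a ≠ 0 → ∃ p, O p a
  hOs : ∀ a ∈ R, ∀ p, O (p + 1) a → ∃ i, O p (y i * a)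
  hR : ∀ a ∈ R, ¬ O 0 a → ∀ i, y i * a ∈ R

lemma Setup.diagR [Nontrivial T] (s : Setup n T) : ∀ (m : ℕ) (κ : Type) [Fintype κ]
    [DecidableEq κ], Fintype.card κ = m → ∀ (ι : Type) [Fintype ι] [DecidableEq ι]
    (A : Matrix ι κ T), (∀ i j, A i j ∈ s.R) → QP n A := by
  intro m
  induction m with
  | zero =>
    intro κ _ _ hκ ι _ _ A hA
    have : IsEmpty κ := Fintype.card_eq_zero_iff.1 hκ
    have : A = 0 := by ext i j; exact this.elim j
    rw [this]; exact QP.zero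
  | succ m ih =>
    intro κ _ _ hκ
    have piv : ∀ (ι : Type) [Fintype ι] [DecidableEq ι] (A : Matrix ι κ T),
        (∀ i j, A i j ∈ s.R) → ∀ i j, s.O 0 (A i j) → QP n A := by
      intro ι _ _ A hA i j hp
      obtain ⟨b, hb, hab, hba⟩ := s.hO0 _ (hA i j) hp
      let e : Unit ⊕ {a // a ≠ i} ≃ ι := ((Equiv.sumComm _ _).trans
        (Equiv.optionEquivSumPUnit _).symm).trans (Equiv.optionSubtypeNe i)
      let f : Unit ⊕ {a // a ≠ j} ≃ κ := ((Equiv.sumComm _ _).trans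
        (Equiv.optionEquivSumPUnit _).symm).trans (Equiv.optionSubtypeNe j)
      refine QP.submatrix A e f ?_
      rw [← fromBlocks_toBlocks (A.submatrix e f)]
      refine QP.elim _ (of fun _ _ => b) _ _ _ ?_ ?_ ?_
      · ext u v
        simpa [Matrix.mul_apply, toBlocks₁₁, e, f] using hab
      · ext u v
        simpa [Matrix.mul_apply, toBlocks₁₁, e, f] using hba
      · refine ih _ ?_ _ _ ?_
        · simp [Fintype.card_subtype_compl, hκ]
        · intro u v
          simp only [Matrix.sub_apply, Matrix.mul_apply]
          refine s.R.sub_mem (hA _ _) (s.R.sum_mem fun _ _ => s.R.mul_mem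
            (s.R.sum_mem fun _ _ => s.R.mul_mem (hA _ _) hb) (hA _ _))
    intro ι _ _ A hA
    by_cases h0 : A = 0
    · rw [h0]; exact QP.zero
    obtain ⟨i, j, hij⟩ : ∃ i j, A i j ≠ 0 := by
      by_contra! h
      exact h0 (by ext i j; exact h i j)
    obtain ⟨p, hp⟩ := s.hO _ (hA i j) hij
    clear h0 hij
    induction p generalizing ι with
    | zero =>
      exact piv ι A hA i j hp
    | succ p ihp =>
      by_cases hz : ∃ i j, s.O 0 (A i j)
      · obtain ⟨i, j, hp⟩ := hz
        exact piv ι A hA i j hp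
      · push Not at hz
        obtain ⟨c, hc⟩ := s.hOs _ (hA i j) p hp
        refine QP.equiv (B := YM ι s.y * A) ?_ A (XM ι s.x) (YM ι s.y) 1 1
          (XM_mul_YM s.hxy) (YM_mul_XM s.hyx) (by simp) (by simp) ?_ (card_mod ι) rfl
        · refine ihp (ι × Fin (n + 1)) (YM ι s.y * A) ?_ (i, c) ?_
          · intro u v
            rw [YM_mul_apply]
            exact s.hR _ (hA _ _) (hz _ _) _
          · rw [YM_mul_apply]; exact hc
        · rw [← Matrix.mul_assoc, XM_mul_YM s.hxy, Matrix.one_mul, Matrix.mul_one]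

lemma Setup.diagF [Nontrivial T] (s : Setup n T) : ∀ (N : ℕ) (κ : Type) [Fintype κ]
    [DecidableEq κ] (ι : Type) [Fintype ι] [DecidableEq ι]
    (A : Matrix ι κ T), (∀ i j, A i j ∈ s.F N) → QP n A := by
  intro N
  induction N with
  | zero =>
    intro κ _ _ ι _ _ A hA
    exact s.diagR _ κ rfl ι A fun i j => s.hF0 (hA i j)
  | succ N ih =>
    intro κ _ _ ι _ _ A hA
    refine QP.equiv (B := A * XM κ s.x) ?_ A 1 1 (YM κ s.y) (XM κ s.x) (by simp) (by simp)
      (YM_mul_XM s.hyx) (XM_mul_YM s.hxy) ?_ rfl (card_mod κ)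
    · refine ih _ _ _ ?_
      intro i j
      rw [mul_XM_apply]
      exact s.hFs _ _ (hA _ _) _
    · rw [Matrix.one_mul, Matrix.mul_assoc, XM_mul_YM s.hxy, Matrix.mul_one]

lemma Setup.diag [Nontrivial T] (s : Setup n T) {κ : Type} [Fintype κ]
    [DecidableEq κ] {ι : Type} [Fintype ι] [DecidableEq ι]
    (A : Matrix ι κ T) : QP n A := by
  choose N hN using fun p : ι × κ => s.hF (A p.1 p.2)
  exact s.diagF (Finset.univ.sup N) κ ι A fun i j =>
    s.hFm (Finset.le_sup (Finset.mem_univ (i, j))) (hN (i, j))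

end Diag

section Cons
open Matrix MulOpposite

variable {n : ℕ} {T : Type u} [Ring T]

def mvL {ι κ : Type} [Fintype κ] (A : Matrix ι κ T) : (κ → T) →ₗ[Tᵐᵒᵖ] (ι → T) where
  toFun v := A *ᵥ v
  map_add' v w := Matrix.mulVec_add A v w
  map_smul' c v := by
    ext i
    simp [Matrix.mulVec, dotProduct, Finset.sum_mul, mul_assoc]

lemma mvL_apply {ι κ : Type} [Fintype κ] (A : Matrix ι κ T) (v : κ → T) :
    mvL A v = A *ᵥ v := rfl

lemma exists_mvL {ι κ : Type} [Fintype κ] [DecidableEq κ] (f : (κ → T) →ₗ[Tᵐᵒᵖ] (ι → T)) :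
    ∃ A : Matrix ι κ T, ∀ v, f v = A *ᵥ v := by
  refine ⟨of fun i j => f (Pi.single j 1) i, fun v => ?_⟩
  have hv : v = ∑ j, op (v j) • (Pi.single j 1 : κ → T) := by
    ext j
    simp [Finset.sum_apply, Pi.single_apply]
  conv_lhs => rw [hv]
  ext i
  simp [map_sum, Finset.sum_apply, Matrix.mulVec, dotProduct]

lemma mat_ext {ι κ : Type} [Fintype κ] [DecidableEq κ] {A B : Matrix ι κ T}
    (h : ∀ v, A *ᵥ v = B *ᵥ v) : A = B := by
  ext i j
  have := congrFun (h (Pi.single j 1)) i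
  simpa using this

lemma Setup.exists_one [Nontrivial T] (s : Setup n T) (a : T) (ha : a ≠ 0) :
    ∃ w u, w * a * u = 1 := by
  obtain ⟨⟨ρ, _, _, U, W, hW, hU⟩, -⟩ := s.diag (of fun _ _ : Unit => a)
  by_cases h : Nonempty ρ
  · obtain ⟨r⟩ := h
    refine ⟨W r (), U () r, ?_⟩
    have := congrFun (congrFun hW r) r
    simpa [Matrix.mul_apply] using this
  · exfalso
    rw [not_nonempty_iff] at h
    have : U * W = 0 := by ext i j; simp [Matrix.mul_apply]
    rw [Matrix.mul_assoc _ U W, this] at hU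
    have := congrFun (congrFun hU ()) ()
    simp at this
    exact ha this.symm

lemma Setup.regular [Nontrivial T] (s : Setup n T) (a : T) : ∃ b, a * b * a = a := by
  obtain ⟨⟨ρ, _, _, U, W, hW, hU⟩, -⟩ := s.diag (of fun _ _ : Unit => a)
  refine ⟨(U * W) () (), ?_⟩
  rw [Matrix.mul_assoc _ U W] at hU
  have := congrFun (congrFun hU ()) ()
  rw [Matrix.mul_apply] at this
  simp only [Finset.univ_unique, Finset.sum_singleton] at this
  rw [Matrix.mul_apply] at this
  simpa using this

lemma Setup.pis [Nontrivial T] (s : Setup n T) (hn : 1 ≤ n) : PurelyInfiniteSimple T := by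
  refine ⟨⟨⟨?_⟩⟩, ?_⟩
  · intro I
    by_cases h : I = ⊥
    · exact Or.inl h
    · right
      obtain ⟨a, haI, ha⟩ : ∃ a ∈ I, a ≠ 0 := by
        by_contra! h'
        apply h
        rw [eq_bot_iff]
        intro a ha
        rw [TwoSidedIdeal.mem_bot]
        exact h' a ha
      obtain ⟨w, u, hw⟩ := s.exists_one a ha
      rw [← TwoSidedIdeal.one_mem_iff, ← hw]
      exact I.mul_mem_right _ _ (I.mul_mem_left _ _ haI)
  · intro I hI
    obtain ⟨a, haI, ha⟩ := (Submodule.ne_bot_iff I).1 hI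
    obtain ⟨w, u, hw⟩ := s.exists_one a ha
    have i01 : (0 : Fin (n + 1)) ≠ ⟨1, by omega⟩ := by
      intro h; have := congrArg Fin.val h; simp at this
    have hyx : s.y 0 * s.x 0 = 1 := by simp [s.hyx]
    have hy01 : s.y 0 * s.x ⟨1, by omega⟩ = 0 := by rw [s.hyx, if_neg i01]
    set X := s.x 0
    set Y := s.y 0
    have hw' : ∀ z, w * (a * (u * z)) = z := fun z => by
      rw [← mul_assoc, ← mul_assoc, hw, one_mul]
    have hyx' : ∀ z, Y * (X * z) = z := fun z => by rw [← mul_assoc, hyx, one_mul]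
    refine ⟨a * u * w, ?_, ?_, a * u * X * Y * w, a * u * (1 - X * Y) * w, ?_, ?_, ?_, ?_, ?_,
      ?_, a * u * Y * w, a * u * X * w, ?_, ?_, ?_, ?_⟩
    · have := I.smul_mem (op (u * w)) haI
      simpa [mul_assoc] using this
    all_goals try simp only [IsIdempotentElem, mul_assoc, hw', hyx', mul_sub, sub_mul, one_mul,
      mul_one, sub_self, sub_zero, add_sub_cancel]
    · intro h0
      have h1 : w * (a * (u * w) - a * (u * (X * (Y * w)))) * (a * (u * s.x ⟨1, by omega⟩)) = 0 := by
        rw [h0]; simp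
      simp only [mul_sub, sub_mul, mul_assoc, hw', hy01, mul_zero, sub_zero] at h1
      have := s.hyx ⟨1, by omega⟩ ⟨1, by omega⟩
      rw [h1] at this
      simp at this

lemma Setup.free [Nontrivial T] (s : Setup n T) (P : Type u) [AddCommGroup P] [Module Tᵐᵒᵖ P]
    (h1 : Module.Finite Tᵐᵒᵖ P) (h2 : Module.Projective Tᵐᵒᵖ P) : Module.Free Tᵐᵒᵖ P := by
  obtain ⟨m, f0, hf0⟩ := Module.Finite.exists_fin' Tᵐᵒᵖ P
  let opE : Tᵐᵒᵖ ≃ₗ[Tᵐᵒᵖ] T :=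
    { toFun := unop, invFun := op, map_add' := fun _ _ => rfl, map_smul' := fun _ _ => rfl,
      left_inv := fun _ => rfl, right_inv := fun _ => rfl }
  let E : (Fin m → Tᵐᵒᵖ) ≃ₗ[Tᵐᵒᵖ] (Fin m → T) := LinearEquiv.piCongrRight fun _ => opE
  let π : (Fin m → T) →ₗ[Tᵐᵒᵖ] P := f0 ∘ₗ E.symm.toLinearMap
  have hπ : Function.Surjective π := hf0.comp E.symm.surjective
  obtain ⟨σ, hσ⟩ := Module.projective_lifting_property π LinearMap.id hπ
  have hσ' : ∀ p, π (σ p) = p := fun p => LinearMap.congr_fun hσ p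
  obtain ⟨A, hA⟩ := exists_mvL (σ ∘ₗ π)
  obtain ⟨⟨ρ, _, _, U, W, hW, hU⟩, -⟩ := s.diag A
  let g : (ρ → T) →ₗ[Tᵐᵒᵖ] P := π ∘ₗ mvL U
  let h : P →ₗ[Tᵐᵒᵖ] (ρ → T) := mvL W ∘ₗ σ
  have hA' : ∀ v, σ (π v) = A *ᵥ v := hA
  have e : P ≃ₗ[Tᵐᵒᵖ] (ρ → T) := LinearEquiv.ofLinearMap h g
    (by
      refine LinearMap.ext fun v => ?_
      simp only [h, g, LinearMap.comp_apply, mvL_apply, hA', Matrix.mulVec_mulVec, LinearMap.id_apply]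
      rw [← Matrix.mul_assoc, hW, Matrix.one_mulVec])
    (by
      refine LinearMap.ext fun p => ?_
      obtain ⟨v, rfl⟩ := hπ p
      have : σ (g (h (π v))) = σ (π v) := by
        simp only [h, g, LinearMap.comp_apply, mvL_apply, hA', Matrix.mulVec_mulVec]
        rw [← Matrix.mul_assoc, ← Matrix.mul_assoc, hU]
      have := congrArg π this
      rw [hσ', hσ'] at this
      exact this)
  let E' : (ρ → Tᵐᵒᵖ) ≃ₗ[Tᵐᵒᵖ] (ρ → T) := LinearEquiv.piCongrRight fun _ => opE
  exact Module.Free.of_equiv (E'.trans e.symm)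

lemma Setup.iso_mod [Nontrivial T] (s : Setup n T) {l m : ℕ}
    (e : (Fin l → T) ≃ₗ[Tᵐᵒᵖ] (Fin m → T)) : l ≡ m [MOD n] := by
  obtain ⟨A, hA⟩ := exists_mvL e.toLinearMap
  obtain ⟨B, hB⟩ := exists_mvL e.symm.toLinearMap
  have hA' : ∀ v, A *ᵥ v = e v := fun v => (hA v).symm
  have hB' : ∀ v, B *ᵥ v = e.symm v := fun v => (hB v).symm
  have := (s.diag A).2 B (mat_ext fun v => by rw [← Matrix.mulVec_mulVec, hA', hB']; simp)
    (mat_ext fun v => by rw [← Matrix.mulVec_mulVec, hA', hB']; simp)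
  simpa using this.symm

lemma Setup.iso_succ (s : Setup n T) (l : ℕ) :
    Nonempty ((Fin (l + 1) → T) ≃ₗ[Tᵐᵒᵖ] (Fin (l + 1 + n) → T)) := by
  let e1 : (Fin 1 → T) ≃ₗ[Tᵐᵒᵖ] (Fin 1 × Fin (n + 1) → T) :=
    LinearEquiv.ofLinearMap (mvL (YM (Fin 1) s.y)) (mvL (XM (Fin 1) s.x))
      (LinearMap.ext fun v => by
        simp [mvL_apply, YM_mul_XM s.hyx])
      (LinearMap.ext fun v => by
        simp [mvL_apply, XM_mul_YM s.hxy])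
  let a : (Fin (l + 1) → T) ≃ₗ[Tᵐᵒᵖ] (Fin l ⊕ Fin 1 → T) :=
    LinearEquiv.funCongrLeft Tᵐᵒᵖ T finSumFinEquiv
  let b : (Fin l ⊕ Fin 1 → T) ≃ₗ[Tᵐᵒᵖ] (Fin l → T) × (Fin 1 → T) :=
    LinearEquiv.sumArrowLequivProdArrow _ _ _ _
  let c : (Fin l ⊕ (Fin 1 × Fin (n + 1)) → T) ≃ₗ[Tᵐᵒᵖ] (Fin l → T) × (Fin 1 × Fin (n + 1) → T) :=
    LinearEquiv.sumArrowLequivProdArrow _ _ _ _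
  have f : Fin (l + 1 + n) ≃ Fin l ⊕ (Fin 1 × Fin (n + 1)) :=
    Fintype.equivOfCardEq (by simp; omega)
  let d : (Fin l ⊕ (Fin 1 × Fin (n + 1)) → T) ≃ₗ[Tᵐᵒᵖ] (Fin (l + 1 + n) → T) :=
    LinearEquiv.funCongrLeft Tᵐᵒᵖ T f
  exact ⟨(a.trans b).trans (((LinearEquiv.refl _ _).prodCongr e1).trans (c.symm.trans d))⟩

lemma Setup.iso_add (s : Setup n T) (l c : ℕ) :
    Nonempty ((Fin (l + 1) → T) ≃ₗ[Tᵐᵒᵖ] (Fin (l + 1 + n * c) → T)) := by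
  induction c with
  | zero => exact ⟨LinearEquiv.refl _ _⟩
  | succ c ih =>
    obtain ⟨e⟩ := ih
    obtain ⟨f⟩ := s.iso_succ (l + n * c)
    have h1 : l + 1 + n * c = l + n * c + 1 := by ring
    have h2 : l + 1 + n * (c + 1) = l + n * c + 1 + n := by ring
    rw [h1] at e
    rw [h2]
    exact ⟨e.trans f⟩

lemma Setup.mod_iso (s : Setup n T) {l m : ℕ} (hl : 1 ≤ l) (hm : 1 ≤ m) (h : l ≡ m [MOD n]) :
    Nonempty ((Fin l → T) ≃ₗ[Tᵐᵒᵖ] (Fin m → T)) := by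
  wlog hlm : l ≤ m generalizing l m
  · obtain ⟨e⟩ := this hm hl h.symm (by omega)
    exact ⟨e.symm⟩
  obtain ⟨c, hc⟩ := (Nat.modEq_iff_dvd' hlm).1 h
  obtain ⟨l, rfl⟩ : ∃ l', l = l' + 1 := ⟨l - 1, by omega⟩
  have : m = l + 1 + n * c := by omega
  rw [this]
  exact s.iso_add l c

end Cons

section Op

variable (k : Type u) [Field k] (d : ℕ) [NeZero d]

/-- The operators `x_i` on sequences. -/
def xop (i : Fin d) : Module.End k (ℕ → k) where
  toFun f m := if m % d = i then f (m / d) else 0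
  map_add' f g := by ext m; by_cases h : m % d = i <;> simp [h]
  map_smul' c f := by ext m; by_cases h : m % d = i <;> simp [h]

/-- The operators `y_i` on sequences. -/
def yop (i : Fin d) : Module.End k (ℕ → k) where
  toFun f m := f (d * m + i)
  map_add' f g := by ext m; simp
  map_smul' c f := by ext m; simp

lemma yop_xop (i j : Fin d) : yop k d i * xop k d j = if i = j then 1 else 0 := by
  ext f m
  have hd : 0 < d := Nat.pos_of_ne_zero (NeZero.ne d)
  have h1 : (d * m + i) % d = i := by rw [Nat.mul_add_mod, Nat.mod_eq_of_lt i.2]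
  have h2 : (d * m + i) / d = m := by
    rw [Nat.mul_add_div hd, Nat.div_eq_of_lt i.2, add_zero]
  by_cases h : i = j
  · subst h
    simp [yop, xop, h1, h2]
  · have h' : (i : ℕ) ≠ j := fun e => h (Fin.ext e)
    simp [yop, xop, h1, h, h']

lemma xop_yop : ∑ i, xop k d i * yop k d i = 1 := by
  ext f m
  have hd : 0 < d := Nat.pos_of_ne_zero (NeZero.ne d)
  simp only [LinearMap.sum_apply, Finset.sum_apply, Module.End.mul_apply, xop, yop,
    LinearMap.coe_mk, AddHom.coe_mk, Module.End.one_apply]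
  rw [Finset.sum_eq_single ⟨m % d, Nat.mod_lt _ hd⟩]
  · simp [Nat.div_add_mod]
  · intro i _ hi
    rw [if_neg]
    intro e
    exact hi (Fin.ext e.symm)
  · simp

end Op

section Constr
open HahnSeries

variable {k : Type u} [Field k] {d : ℕ} {A : Type u} [Ring A] [Algebra k A]

/-- Homogeneous components of the free algebra. -/
def BB (k : Type u) [Field k] {A : Type u} [Ring A] [Algebra k A] (x : Fin d → A) :
    ℕ → Submodule k A
  | 0 => 1
  | N + 1 => ⨆ i, (BB k x N).map (LinearMap.mulLeft k (x i))

variable (x y : Fin d → A)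

lemma BB_succ (N : ℕ) : BB k x (N + 1) = ⨆ i, (BB k x N).map (LinearMap.mulLeft k (x i)) := rfl

lemma x_mul_mem {N : ℕ} {a : A} (i : Fin d) (ha : a ∈ BB k x N) : x i * a ∈ BB k x (N + 1) :=
  Submodule.mem_iSup_of_mem i ⟨a, ha, rfl⟩

lemma BB_mul {N M : ℕ} {a b : A} (ha : a ∈ BB k x N) (hb : b ∈ BB k x M) :
    a * b ∈ BB k x (N + M) := by
  induction N generalizing a with
  | zero =>
    obtain ⟨c, rfl⟩ := Submodule.mem_one.1 ha
    rw [zero_add, ← Algebra.smul_def]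
    exact Submodule.smul_mem _ _ hb
  | succ N ih =>
    rw [BB_succ] at ha
    induction ha using Submodule.iSup_induction' with
    | mem i a ha =>
      obtain ⟨a, ha, rfl⟩ := ha
      simp only [LinearMap.mulLeft_apply, mul_assoc]
      rw [add_right_comm]
      exact x_mul_mem x i (ih ha)
    | zero => simp
    | add a a' _ _ h h' => rw [add_mul]; exact Submodule.add_mem _ h h'

lemma y_mul_mem (hyx : ∀ i j, y i * x j = if i = j then 1 else 0) {N : ℕ} {a : A} (i : Fin d)
    (ha : a ∈ BB k x (N + 1)) : y i * a ∈ BB k x N := by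
  rw [BB_succ] at ha
  induction ha using Submodule.iSup_induction' with
  | mem j a ha =>
    obtain ⟨a, ha, rfl⟩ := ha
    simp only [LinearMap.mulLeft_apply]
    rw [← mul_assoc, hyx]
    split_ifs
    · simpa using ha
    · simp
  | zero => simp
  | add a a' _ _ h h' => rw [mul_add]; exact Submodule.add_mem _ h h'

/-- Noncommutative power series. -/
def R0 (k : Type u) [Field k] {A : Type u} [Ring A] [Algebra k A] (x : Fin d → A) :
    Subring (PowerSeries A) where
  carrier := {f | ∀ N, PowerSeries.coeff N f ∈ BB k x N}
  mul_mem' {f g} hf hg N := by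
    rw [PowerSeries.coeff_mul]
    refine Submodule.sum_mem _ fun p hp => ?_
    rw [← Finset.HasAntidiagonal.mem_antidiagonal.1 hp]
    exact BB_mul x (hf _) (hg _)
  one_mem' N := by
    rw [PowerSeries.coeff_one]
    split_ifs with h
    · subst h; exact (Submodule.mem_one.2 ⟨1, map_one _⟩)
    · exact Submodule.zero_mem _
  add_mem' hf hg N := by simpa using Submodule.add_mem _ (hf N) (hg N)
  zero_mem' N := by simp
  neg_mem' hf N := by simpa using hf N

lemma mem_R0 {f : PowerSeries A} : f ∈ R0 k x ↔ ∀ N, PowerSeries.coeff N f ∈ BB k x N := Iff.rfl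

lemma R0_inv {f : PowerSeries A} (hf : f ∈ R0 k x) (h0 : PowerSeries.coeff 0 f ≠ 0) :
    ∃ g ∈ R0 k x, f * g = 1 ∧ g * f = 1 := by
  obtain ⟨c, hc⟩ := Submodule.mem_one.1 (hf 0)
  have hc0 : c ≠ 0 := by
    rintro rfl
    apply h0
    rw [← hc]; simp
  let u : Aˣ := Units.map (algebraMap k A).toMonoidHom (Units.mk0 c hc0)
  have hu : PowerSeries.constantCoeff f = u := by
    rw [← PowerSeries.coeff_zero_eq_constantCoeff_apply, ← hc]; rfl
  have hui : ((u⁻¹ : Aˣ) : A) = algebraMap k A c⁻¹ := by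
    rw [← map_inv]; simp
  refine ⟨PowerSeries.invOfUnit f u, ?_, PowerSeries.mul_invOfUnit f u hu,
    PowerSeries.invOfUnit_mul f u hu⟩
  intro N
  induction N using Nat.strong_induction_on with
  | _ N ih =>
    rw [PowerSeries.coeff_invOfUnit, hui]
    split_ifs with h
    · subst h
      exact Submodule.mem_one.2 ⟨_, rfl⟩
    · rw [neg_mul, ← Algebra.smul_def]
      refine Submodule.neg_mem _ (Submodule.smul_mem _ _ (Submodule.sum_mem _ fun p hp => ?_))
      split_ifs with h2
      · rw [← Finset.HasAntidiagonal.mem_antidiagonal.1 hp]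
        exact BB_mul x (hf _) (ih _ h2)
      · exact Submodule.zero_mem _

/-- The image of the power series in the Laurent series. -/
noncomputable def RR (k : Type u) [Field k] {A : Type u} [Ring A] [Algebra k A] (x : Fin d → A) :
    Subring (HahnSeries ℤ A) := (R0 k x).map (HahnSeries.ofPowerSeries ℤ A)

noncomputable def XX (i : Fin d) : HahnSeries ℤ A := single 1 (x i)
noncomputable def YY (i : Fin d) : HahnSeries ℤ A := single (-1) (y i)

lemma YY_XX (hyx : ∀ i j, y i * x j = if i = j then 1 else 0) (i j : Fin d) :
    YY y i * XX x j = if i = j then 1 else 0 := by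
  simp only [XX, YY, single_mul_single, hyx]
  split_ifs <;> simp

lemma XX_YY (hxy : ∑ i, x i * y i = 1) : ∑ i, XX x i * YY y i = 1 := by
  simp only [XX, YY, single_mul_single]
  rw [← HahnSeries.single_zero_one, ← hxy]
  simp only [add_neg_cancel]
  exact (map_sum (HahnSeries.C (Γ := ℤ) (R := A)) (fun i => x i * y i) Finset.univ).symm

lemma XX_mem (i : Fin d) : XX x i ∈ RR k x := by
  refine ⟨PowerSeries.C (x i) * PowerSeries.X, ?_, ?_⟩
  · intro N
    rcases N with _ | _ | N
    · simp
    · have := x_mul_mem (k := k) x (N := 0) (a := 1) i (Submodule.mem_one.2 ⟨1, map_one _⟩)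
      simpa using this
    · simp
  · rw [map_mul, HahnSeries.ofPowerSeries_X, HahnSeries.ofPowerSeries_C]
    simp [XX, HahnSeries.C_apply, single_mul_single]

lemma alg_mem (c : k) : algebraMap k (HahnSeries ℤ A) c ∈ RR k x := by
  refine ⟨PowerSeries.C (algebraMap k A c), ?_, ?_⟩
  · intro N
    rw [PowerSeries.coeff_C]
    split_ifs with h
    · subst h; exact Submodule.mem_one.2 ⟨_, rfl⟩
    · exact Submodule.zero_mem _
  · rw [HahnSeries.ofPowerSeries_C, HahnSeries.algebraMap_apply]

lemma YY_mul_mem (hyx : ∀ i j, y i * x j = if i = j then 1 else 0) {r : HahnSeries ℤ A}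
    (hr : r ∈ RR k x) (h0 : r.coeff 0 = 0) (i : Fin d) : YY y i * r ∈ RR k x := by
  obtain ⟨f, hf, rfl⟩ := hr
  have h0' : PowerSeries.coeff 0 f = 0 := by
    rw [← HahnSeries.ofPowerSeries_apply_coeff (Γ := ℤ)]; exact h0
  let g : PowerSeries A := PowerSeries.mk fun N => PowerSeries.coeff (N + 1) f
  have hg : f = PowerSeries.X * g := by
    ext N
    cases N with
    | zero => rw [h0']; simp
    | succ N => rw [PowerSeries.coeff_succ_X_mul]; simp [g]
  refine ⟨PowerSeries.C (y i) * g, ?_, ?_⟩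
  · intro N
    rw [PowerSeries.coeff_C_mul]
    simp only [g, PowerSeries.coeff_mk]
    exact y_mul_mem x y hyx i (hf _)
  · rw [hg, map_mul, map_mul, HahnSeries.ofPowerSeries_X, HahnSeries.ofPowerSeries_C, ← mul_assoc,
      YY, single_mul_single]
    simp [HahnSeries.C_apply]

lemma coeff_YY_mul (i : Fin d) (r : HahnSeries ℤ A) (p : ℕ) :
    (YY y i * r).coeff (p : ℤ) = y i * r.coeff ((p + 1 : ℕ) : ℤ) := by
  have := HahnSeries.coeff_single_mul_add (r := y i) (x := r) (a := ((p + 1 : ℕ) : ℤ)) (b := -1)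
  rw [← this, YY]
  congr 1
  push_cast; ring

lemma coeff_mul_XX_zero {r : HahnSeries ℤ A} (hr : r ∈ RR k x) (i : Fin d) :
    (r * XX x i).coeff 0 = 0 := by
  obtain ⟨f, hf, rfl⟩ := hr
  have : ofPowerSeries ℤ A f * XX x i =
      ofPowerSeries ℤ A (f * (PowerSeries.C (x i) * PowerSeries.X)) := by
    rw [map_mul, map_mul, HahnSeries.ofPowerSeries_X, HahnSeries.ofPowerSeries_C]
    simp [XX, HahnSeries.C_apply, single_mul_single]
  rw [this]
  have := HahnSeries.ofPowerSeries_apply_coeff (Γ := ℤ)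
    (f * (PowerSeries.C (x i) * PowerSeries.X)) 0
  rw [Nat.cast_zero] at this
  rw [this, ← mul_assoc]
  simp

/-- The filtration of the localization. -/
noncomputable def TF (k : Type u) [Field k] {A : Type u} [Ring A] [Algebra k A] (x : Fin d → A) :
    ℕ → AddSubgroup (HahnSeries ℤ A)
  | 0 => (RR k x).toAddSubgroup
  | N + 1 => ⨅ i, (TF k x N).comap (AddMonoidHom.mulRight (XX x i))

lemma mem_TF_succ {N : ℕ} {t : HahnSeries ℤ A} :
    t ∈ TF k x (N + 1) ↔ ∀ i, t * XX x i ∈ TF k x N := by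
  simp [TF, AddSubgroup.mem_iInf]

lemma mem_TF_zero {t : HahnSeries ℤ A} : t ∈ TF k x 0 ↔ t ∈ RR k x := Iff.rfl

lemma TF_mono : Monotone (TF k x) := by
  refine monotone_nat_of_le_succ fun N => ?_
  induction N with
  | zero =>
    intro t ht
    rw [mem_TF_succ]
    intro i
    exact (RR k x).mul_mem ht (XX_mem x i)
  | succ N ih =>
    intro t ht
    rw [mem_TF_succ] at ht ⊢
    exact fun i => ih (ht i)

lemma TF_mul_RR (hyx : ∀ i j, y i * x j = if i = j then 1 else 0) (hxy : ∑ i, x i * y i = 1)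
    {N : ℕ} {t r : HahnSeries ℤ A} (ht : t ∈ TF k x N) (hr : r ∈ RR k x) :
    t * r ∈ TF k x N := by
  induction N generalizing t r with
  | zero => exact (RR k x).mul_mem ht hr
  | succ N ih =>
    rw [mem_TF_succ] at ht ⊢
    intro i
    have : t * r * XX x i = ∑ j, (t * XX x j) * (YY y j * (r * XX x i)) := by
      calc t * r * XX x i = t * (∑ j, XX x j * YY y j) * (r * XX x i) := by
            rw [XX_YY x y hxy, mul_one, mul_assoc]
        _ = _ := by simp only [Finset.mul_sum, Finset.sum_mul, mul_assoc]
    rw [this]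
    refine AddSubgroup.sum_mem _ fun j _ => ih (ht j) ?_
    exact YY_mul_mem x y hyx ((RR k x).mul_mem hr (XX_mem x i)) (coeff_mul_XX_zero x hr i) j

lemma TF_mul (hyx : ∀ i j, y i * x j = if i = j then 1 else 0) (hxy : ∑ i, x i * y i = 1)
    {N M : ℕ} {t s : HahnSeries ℤ A} (ht : t ∈ TF k x N) (hs : s ∈ TF k x M) :
    t * s ∈ TF k x (N + M) := by
  induction M generalizing s with
  | zero => exact TF_mul_RR x y hyx hxy ht hs
  | succ M ih =>
    rw [mem_TF_succ] at hs
    rw [← add_assoc, mem_TF_succ]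
    intro i
    rw [mul_assoc]
    exact ih (hs i)

/-- The algebra of the theorem. -/
noncomputable def TT (hyx : ∀ i j, y i * x j = if i = j then 1 else 0) (hxy : ∑ i, x i * y i = 1) :
    Subalgebra k (HahnSeries ℤ A) where
  carrier := {t | ∃ N, t ∈ TF k x N}
  mul_mem' := by
    rintro a b ⟨N, ha⟩ ⟨M, hb⟩
    exact ⟨_, TF_mul x y hyx hxy ha hb⟩
  add_mem' := by
    rintro a b ⟨N, ha⟩ ⟨M, hb⟩
    exact ⟨max N M, AddSubgroup.add_mem _ (TF_mono x (le_max_left _ _) ha)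
      (TF_mono x (le_max_right _ _) hb)⟩
  algebraMap_mem' c := ⟨0, alg_mem x c⟩

lemma mem_TT (hyx : ∀ i j, y i * x j = if i = j then 1 else 0) (hxy : ∑ i, x i * y i = 1)
    {t : HahnSeries ℤ A} : t ∈ TT (k := k) x y hyx hxy ↔ ∃ N, t ∈ TF k x N := Iff.rfl

noncomputable def theSetup {n : ℕ} (x y : Fin (n + 1) → A)
    (hyx : ∀ i j, y i * x j = if i = j then 1 else 0) (hxy : ∑ i, x i * y i = 1) :
    Setup n (TT (k := k) x y hyx hxy) where
  R := (RR k x).comap (TT (k := k) x y hyx hxy).val.toRingHom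
  x i := ⟨XX x i, 0, XX_mem x i⟩
  y i := ⟨YY y i, 1, by
    rw [mem_TF_succ]
    intro j
    rw [YY_XX x y hyx]
    split_ifs
    · exact (RR k x).one_mem
    · exact (RR k x).zero_mem⟩
  hyx i j := by
    apply Subtype.ext
    have := YY_XX x y hyx i j
    split_ifs with h
    · simpa [h] using this
    · simpa [h] using this
  hxy := by
    apply Subtype.ext
    have := XX_YY x y hxy
    simpa using this
  F N := {t | (t : HahnSeries ℤ A) ∈ TF k x N}
  hF0 := fun t ht => ht
  hFs N a ha i := (mem_TF_succ x).1 ha i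
  hFm := fun N M h t ht => TF_mono x h ht
  hF a := a.2
  O p a := (a : HahnSeries ℤ A).coeff (p : ℤ) ≠ 0
  hO0 := by
    rintro ⟨a, ha'⟩ ha h0
    obtain ⟨f, hf, rfl⟩ := ha
    have h0' : PowerSeries.coeff 0 f ≠ 0 := by
      rw [← HahnSeries.ofPowerSeries_apply_coeff (Γ := ℤ)]; exact h0
    obtain ⟨g, hg, h1, h2⟩ := R0_inv x hf h0'
    refine ⟨⟨ofPowerSeries ℤ A g, 0, ⟨g, hg, rfl⟩⟩, ⟨g, hg, rfl⟩, ?_, ?_⟩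
    · apply Subtype.ext
      change ofPowerSeries ℤ A f * ofPowerSeries ℤ A g = 1
      rw [← map_mul, h1, map_one]
    · apply Subtype.ext
      change ofPowerSeries ℤ A g * ofPowerSeries ℤ A f = 1
      rw [← map_mul, h2, map_one]
  hO := by
    rintro ⟨a, ha'⟩ ha h0
    obtain ⟨f, hf, rfl⟩ := ha
    by_contra! h
    apply h0
    apply Subtype.ext
    have : f = 0 := by
      ext N
      rw [← HahnSeries.ofPowerSeries_apply_coeff (Γ := ℤ)]
      exact h N
    change ofPowerSeries ℤ A f = 0
    rw [this, map_zero]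
  hOs := by
    rintro ⟨a, ha'⟩ ha p hp
    by_contra! h
    apply hp
    have h' : ∀ i, y i * a.coeff ((p + 1 : ℕ) : ℤ) = 0 := fun i => by
      rw [← coeff_YY_mul]; exact h i
    change a.coeff ((p + 1 : ℕ) : ℤ) = 0
    rw [← one_mul (a.coeff _), ← hxy, Finset.sum_mul]
    refine Finset.sum_eq_zero fun i _ => ?_
    rw [mul_assoc, h', mul_zero]
  hR := by
    rintro ⟨a, ha'⟩ ha h0 i
    exact YY_mul_mem x y hyx ha (not_not.1 h0) i

end Constr

/-- For every field `k` and `n ≥ 1` there is a `k`-algebra `T` which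
is von Neumann regular, purely infinite simple, over which every finitely generated
projective right module is free, and such that `T^ℓ ≅ T^m` (as right `T`-modules) iff
`ℓ ≡ m (mod n)` for all `ℓ, m ≥ 1`. -/
theorem stmt15 (k : Type u) [Field k] (n : ℕ) (hn : 1 ≤ n) :
    ∃ (T : Type u) (_ : Ring T) (_ : Algebra k T),
      (∀ a : T, ∃ b : T, a * b * a = a) ∧
      PurelyInfiniteSimple T ∧
      (∀ (P : Type u) [AddCommGroup P] [Module Tᵐᵒᵖ P],
        Module.Finite Tᵐᵒᵖ P → Module.Projective Tᵐᵒᵖ P → Module.Free Tᵐᵒᵖ P) ∧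
      (∀ ℓ m : ℕ, 1 ≤ ℓ → 1 ≤ m →
        (Nonempty ((Fin ℓ → T) ≃ₗ[Tᵐᵒᵖ] (Fin m → T)) ↔ ℓ ≡ m [MOD n])) := by
  let T := TT (k := k) _ _ (yop_xop k (n + 1)) (xop_yop k (n + 1))
  have s : Setup n T := theSetup _ _ (yop_xop k (n + 1)) (xop_yop k (n + 1))
  refine ⟨T, inferInstance, inferInstance, fun a => s.regular a, s.pis hn,
    fun P _ _ h1 h2 => s.free P h1 h2, fun l m hl hm => ⟨fun ⟨e⟩ => s.iso_mod e, s.mod_iso hl hm⟩⟩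
end

section
/- For every field k there exists a k-algebra S such that S is von Neumann regular, S is a purely infinite simple ring, and for all integers ℓ, m ≥ 1 the free right S-modules S^ℓ and S^m are isomorphic if and only if ℓ = m. -/
universe u v w

namespace PIS

/-- finite rank -/
def FR {k X Y : Type*} [Field k] [AddCommGroup X] [AddCommGroup Y] [Module k X] [Module k Y]
    (f : X →ₗ[k] Y) : Prop := Module.Finite k (LinearMap.range f)

section FRsec
variable {k : Type*} {X Y Z : Type v} [Field k] [AddCommGroup X] [AddCommGroup Y] [AddCommGroup Z]
  [Module k X] [Module k Y] [Module k Z]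

theorem FR.of_le {f : X →ₗ[k] Y} (p : Submodule k Y) [Module.Finite k p]
    (h : ∀ x, f x ∈ p) : FR f := by
  have : LinearMap.range f ≤ p := by rintro _ ⟨x, rfl⟩; exact h x
  exact Submodule.finiteDimensional_of_le this

theorem FR.zero : FR (0 : X →ₗ[k] Y) := FR.of_le ⊥ (by simp)

theorem FR.add {f g : X →ₗ[k] Y} (hf : FR f) (hg : FR g) : FR (f + g) := by
  unfold FR at hf hg
  exact FR.of_le (LinearMap.range f ⊔ LinearMap.range g) fun x =>
    Submodule.add_mem_sup ⟨x, rfl⟩ ⟨x, rfl⟩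

theorem FR.neg {f : X →ₗ[k] Y} (hf : FR f) : FR (-f) := by
  unfold FR at hf
  exact FR.of_le (LinearMap.range f) fun x => ⟨-x, by simp⟩

theorem FR.sub {f g : X →ₗ[k] Y} (hf : FR f) (hg : FR g) : FR (f - g) := by
  rw [sub_eq_add_neg]; exact hf.add hg.neg

theorem FR.comp_left {f : X →ₗ[k] Y} (hf : FR f) (g : Y →ₗ[k] Z) : FR (g ∘ₗ f) := by
  unfold FR at hf
  exact FR.of_le ((LinearMap.range f).map g) fun x => ⟨f x, ⟨x, rfl⟩, rfl⟩

theorem FR.comp_right {f : Y →ₗ[k] Z} (hf : FR f) (g : X →ₗ[k] Y) : FR (f ∘ₗ g) := by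
  unfold FR at hf
  exact FR.of_le (LinearMap.range f) fun x => ⟨g x, rfl⟩

theorem FR.sum {ι : Type*} (s : Finset ι) {f : ι → (X →ₗ[k] Y)} (hf : ∀ i, FR (f i)) :
    FR (∑ i ∈ s, f i) := by
  classical
  induction s using Finset.induction_on with
  | empty => simpa using FR.zero
  | insert a s ha ih => rw [Finset.sum_insert ha]; exact (hf a).add ih

theorem FR.of_dom [Module.Finite k X] (f : X →ₗ[k] Y) : FR f := by
  unfold FR; infer_instance

theorem exists_qinv (f : X →ₗ[k] Y) : ∃ g : Y →ₗ[k] X, ∀ x, f (g (f x)) = f x := by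
  obtain ⟨s, hs⟩ := f.rangeRestrict.exists_rightInverse_of_surjective f.range_rangeRestrict
  obtain ⟨p, hp⟩ := (LinearMap.range f).subtype.exists_leftInverse_of_injective (by simp)
  refine ⟨s ∘ₗ p, fun x => ?_⟩
  have h1 : p (f x) = f.rangeRestrict x := LinearMap.congr_fun hp (f.rangeRestrict x)
  have h2 := LinearMap.congr_fun hs (f.rangeRestrict x)
  simp only [LinearMap.comp_apply, h1]
  exact congrArg Subtype.val h2

/-- codimension additivity -/
theorem codim_map (A : X →ₗ[k] Y) (hA : Function.Injective A) (K : Submodule k X) :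
    Module.rank k (Y ⧸ K.map A) = Module.rank k (X ⧸ K) + Module.rank k (Y ⧸ LinearMap.range A) := by
  let g : (X ⧸ K) →ₗ[k] (Y ⧸ K.map A) := K.mapQ (K.map A) A (Submodule.le_comap_map A K)
  have hg : Function.Injective g := by
    rw [← LinearMap.ker_eq_bot, Submodule.ker_mapQ, Submodule.comap_map_eq_of_injective hA]
    simp
  have hr : LinearMap.range g = (LinearMap.range A).map (K.map A).mkQ := by
    rw [Submodule.range_mapQ]
  have h1 := Submodule.rank_quotient_add_rank (LinearMap.range g)
  have e1 := (LinearEquiv.ofInjective g hg).rank_eq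
  have hle : K.map A ≤ LinearMap.range A := LinearMap.map_le_range
  have e2 := (Submodule.quotientQuotientEquivQuotient (K.map A) (LinearMap.range A) hle).rank_eq
  rw [← h1, ← e1, hr, e2, add_comm]

theorem index_eq (A B : X →ₗ[k] Y) (hA : Function.Injective A) (hB : Function.Injective B)
    (h : FR (A - B)) (a b : ℕ) (ha : Module.rank k (Y ⧸ LinearMap.range A) = a)
    (hb : Module.rank k (Y ⧸ LinearMap.range B) = b) : a = b := by
  let K := LinearMap.ker (A - B)
  have hK : K.map A = K.map B := by
    ext y
    constructor
    · rintro ⟨x, hx, rfl⟩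
      refine ⟨x, hx, ?_⟩
      have : A x - B x = 0 := hx
      exact (sub_eq_zero.mp this).symm
    · rintro ⟨x, hx, rfl⟩
      refine ⟨x, hx, ?_⟩
      have : A x - B x = 0 := hx
      exact (sub_eq_zero.mp this)
  have h1 := codim_map A hA K
  have h2 := codim_map B hB K
  unfold FR at h
  have e := (A - B).quotKerEquivRange.rank_eq
  have hd := Module.finrank_eq_rank k (LinearMap.range (A - B))
  rw [hK, h2, ha, hb, e, ← hd] at h1
  have : (Module.finrank k (LinearMap.range (A-B)) + b : ℕ) = (Module.finrank k (LinearMap.range (A-B)) + a) := by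
    exact_mod_cast h1
  omega
end FRsec

section constr
variable (k : Type u) [Field k]

/-- base space -/
def U := ℕ →₀ k
noncomputable instance : AddCommGroup (U k) := inferInstanceAs (AddCommGroup (ℕ →₀ k))
noncomputable instance : Module k (U k) := inferInstanceAs (Module k (ℕ →₀ k))
/-- base space plus one dimension -/
abbrev W := k × U k
/-- multiplicity space -/
abbrev M := ℕ →₀ (U k × W k)

/-- inclusion -/
noncomputable abbrev T : U k →ₗ[k] W k := LinearMap.inr k k (U k)
/-- projection -/
noncomputable abbrev Ts : W k →ₗ[k] U k := LinearMap.snd k k (U k)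

theorem rankU : Module.rank k (U k) = Cardinal.aleph0 := by
  have : Module.rank k (ℕ →₀ k) = Cardinal.aleph0 := by simp
  exact this
theorem exE : Nonempty ((U k × M k) ≃ₗ[k] U k) := by
  rw [Module.nonempty_linearEquiv_iff_rank_eq]
  have h : (1 : Cardinal.{u}) + Cardinal.aleph0 = Cardinal.aleph0 :=
    Cardinal.add_eq_right le_rfl Cardinal.one_le_aleph0
  simp [h, rankU]
theorem exWU : Nonempty ((W k) ≃ₗ[k] U k) := by
  rw [Module.nonempty_linearEquiv_iff_rank_eq]
  have h : (1 : Cardinal.{u}) + Cardinal.aleph0 = Cardinal.aleph0 :=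
    Cardinal.add_eq_right le_rfl Cardinal.one_le_aleph0
  simp [h, rankU]

/-- absorbing iso -/
noncomputable def e : (U k × M k) ≃ₗ[k] U k := (exE k).some
/-- absorbing iso on `W` -/
noncomputable def e' : (W k × M k) ≃ₗ[k] W k :=
  (LinearEquiv.prodAssoc k k (U k) (M k)).trans ((LinearEquiv.refl k k).prodCongr (e k))
/-- iso -/
noncomputable def wu : W k ≃ₗ[k] U k := (exWU k).some

theorem e'_apply (w : W k) (m : M k) : e' k (w, m) = (w.1, e k (w.2, m)) := rfl
theorem e'_T (x : U k) (m : M k) : e' k (T k x, m) = T k (e k (x, m)) := rfl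

theorem FR_TT : FR (T k ∘ₗ Ts k - LinearMap.id) := by
  have : T k ∘ₗ Ts k - LinearMap.id = - (LinearMap.inl k k (U k) ∘ₗ LinearMap.fst k k (U k)) := by
    ext <;> simp
  rw [this]
  exact ((FR.of_dom (LinearMap.inl k k (U k))).comp_right _).neg

/-- pairs intertwined by `T` modulo finite rank -/
def P : Subalgebra k (Module.End k (U k) × Module.End k (W k)) where
  carrier := {p | FR (p.2 ∘ₗ T k - T k ∘ₗ p.1)}
  mul_mem' := by
    rintro ⟨a, b⟩ ⟨c, d⟩ h1 h2
    have : (b * d) ∘ₗ T k - T k ∘ₗ (a * c) =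
      b ∘ₗ (d ∘ₗ T k - T k ∘ₗ c) + (b ∘ₗ T k - T k ∘ₗ a) ∘ₗ c := by
      apply LinearMap.ext; intro x
      simp only [LinearMap.sub_apply, LinearMap.add_apply, LinearMap.comp_apply, Module.End.mul_apply,
        map_sub]
      abel
    show FR ((b * d) ∘ₗ T k - T k ∘ₗ (a * c))
    rw [this]
    exact (FR.comp_left h2 _).add (FR.comp_right h1 _)
  add_mem' := by
    rintro ⟨a, b⟩ ⟨c, d⟩ h1 h2
    have : (b + d) ∘ₗ T k - T k ∘ₗ (a + c) =
      (d ∘ₗ T k - T k ∘ₗ c) + (b ∘ₗ T k - T k ∘ₗ a) := by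
      apply LinearMap.ext; intro x
      simp only [LinearMap.sub_apply, LinearMap.add_apply, LinearMap.comp_apply,
        map_add]
      abel
    show FR ((b + d) ∘ₗ T k - T k ∘ₗ (a + c))
    rw [this]
    exact FR.add h2 h1
  algebraMap_mem' := by
    intro r
    have : (algebraMap k (Module.End k (U k) × Module.End k (W k)) r).2 ∘ₗ T k
       - T k ∘ₗ (algebraMap k (Module.End k (U k) × Module.End k (W k)) r).1 = 0 := by
      apply LinearMap.ext; intro x
      simp [Module.algebraMap_end_apply]
    show FR _
    rw [this]; exact FR.zero

variable {k}
noncomputable instance instRingP : Ring (P k) := Subalgebra.toRing (P k)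

theorem ring_id {R : Type*} [Ring R] (b d g : R) :
    b * (d + (1 - d * b) * g * (1 - b * d)) * b = b * d * b + (b - b * d * b) * g * (b - b * d * b) := by
  simp only [mul_add, add_mul, mul_sub, sub_mul, one_mul, mul_one, mul_assoc]

theorem P_reg (p : P k) : ∃ q : P k, p * q * p = p := by
  obtain ⟨⟨a, b⟩, hp⟩ := p
  have hp : FR (b ∘ₗ T k - T k ∘ₗ a) := hp
  obtain ⟨c, hc⟩ := exists_qinv a
  let d0 : Module.End k (W k) := T k ∘ₗ c ∘ₗ Ts k
  let r : Module.End k (W k) := b - T k ∘ₗ a ∘ₗ Ts k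
  have hr : FR r := by
    have : r = (b ∘ₗ T k - T k ∘ₗ a) ∘ₗ Ts k - b ∘ₗ (T k ∘ₗ Ts k - LinearMap.id) := by
      apply LinearMap.ext; intro x
      simp only [r, LinearMap.sub_apply, LinearMap.comp_apply, map_sub, LinearMap.id_apply]
      abel
    rw [this]
    exact (hp.comp_right _).sub ((FR_TT k).comp_left _)
  let h : Module.End k (W k) := b - b * d0 * b
  have hh : FR h := by
    have : h = r - r ∘ₗ (d0 ∘ₗ b) - (T k ∘ₗ a ∘ₗ Ts k ∘ₗ d0) ∘ₗ r := by
      apply LinearMap.ext; intro x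
      have hx : b x = T k (a (Ts k x)) + r x := by simp [r]
      have h2 : ∀ y, b y = T k (a (Ts k y)) + r y := by simp [r]
      have h3 : b (d0 (b x)) = T k (a (Ts k (d0 (T k (a (Ts k x)) + r x)))) + r (d0 (b x)) := by
        rw [h2 (d0 (b x))]; rw [hx]
      have h4 : T k (a (Ts k (d0 (T k (a (Ts k x)))))) = T k (a (Ts k x)) := by
        show T k (a (c (a (Ts k x)))) = _
        rw [hc]
      simp only [h, LinearMap.sub_apply, LinearMap.comp_apply, Module.End.mul_apply]
      rw [h3, map_add, map_add, map_add, map_add, h4, hx]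
      abel
    rw [this]
    exact (hr.sub (hr.comp_right _)).sub (hr.comp_left _)
  obtain ⟨g, hg⟩ := exists_qinv h
  let g' : Module.End k (W k) := g * h * g
  have hg' : FR g' := (hh.comp_right g).comp_left g
  have hgh : h * g' * h = h := by
    apply LinearMap.ext; intro x
    simp [g', hg]
  let d : Module.End k (W k) := d0 + (1 - d0 * b) * g' * (1 - b * d0)
  have hd : FR (d ∘ₗ T k - T k ∘ₗ c) := by
    have : d ∘ₗ T k - T k ∘ₗ c = ((1 - d0 * b) ∘ₗ g') ∘ₗ ((1 - b * d0) ∘ₗ T k) := by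
      apply LinearMap.ext; intro x
      simp [d, d0]
    rw [this]
    exact (hg'.comp_left _).comp_right _
  refine ⟨⟨(c, d), hd⟩, ?_⟩
  apply Subtype.ext
  apply Prod.ext
  · apply LinearMap.ext; intro x
    exact hc x
  · show b * d * b = b
    have : b * d * b = b * d0 * b + h * g' * h := by
      simp only [d, h]; exact ring_id b d0 g'
    rw [this, hgh]; exact add_sub_cancel (b * d0 * b) b

/-- diagonal action on `M` -/
noncomputable def N (p : Module.End k (U k) × Module.End k (W k)) : Module.End k (M k) :=
  Finsupp.mapRange.linearMap (p.1.prodMap p.2)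

theorem N_apply (p : Module.End k (U k) × Module.End k (W k)) (m : M k) (n : ℕ) :
    N p m n = (p.1 (m n).1, p.2 (m n).2) := by
  simp [N]

theorem N_mul (p q : Module.End k (U k) × Module.End k (W k)) (m : M k) :
    N (p * q) m = N p (N q m) := by
  ext1 n; simp [N_apply]
theorem N_one (m : M k) : N (1 : Module.End k (U k) × Module.End k (W k)) m = m := by
  ext1 n; simp [N_apply]
theorem N_add (p q : Module.End k (U k) × Module.End k (W k)) (m : M k) :
    N (p + q) m = N p m + N q m := by
  ext1 n; simp [N_apply]
theorem N_smul (r : k) (p : Module.End k (U k) × Module.End k (W k)) (m : M k) :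
    N (r • p) m = r • N p m := by
  ext1 n; simp [N_apply]

/-- first component -/
noncomputable def phi1 (p : Module.End k (U k) × Module.End k (W k)) : Module.End k (U k) :=
  (e k).toLinearMap ∘ₗ (p.1.prodMap (N p)) ∘ₗ (e k).symm.toLinearMap
/-- second component -/
noncomputable def phi2 (p : Module.End k (U k) × Module.End k (W k)) : Module.End k (W k) :=
  (e' k).toLinearMap ∘ₗ (p.2.prodMap (N p)) ∘ₗ (e' k).symm.toLinearMap

theorem phi1_e (p : Module.End k (U k) × Module.End k (W k)) (x : U k) (m : M k) :
    phi1 p (e k (x, m)) = e k (p.1 x, N p m) := by simp [phi1]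
theorem phi2_e (p : Module.End k (U k) × Module.End k (W k)) (x : W k) (m : M k) :
    phi2 p (e' k (x, m)) = e' k (p.2 x, N p m) := by simp [phi2]

theorem ext_e {f g : Module.End k (U k)} (h : ∀ x m, f (e k (x, m)) = g (e k (x, m))) : f = g := by
  apply LinearMap.ext; intro x
  have := h ((e k).symm x).1 ((e k).symm x).2
  simpa using this
theorem ext_e' {f g : Module.End k (W k)} (h : ∀ x m, f (e' k (x, m)) = g (e' k (x, m))) :
    f = g := by
  apply LinearMap.ext; intro x
  have := h ((e' k).symm x).1 ((e' k).symm x).2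
  rw [Prod.mk.eta, LinearEquiv.apply_symm_apply] at this
  exact this

theorem phi_mem (p : P k) : FR (phi2 p.1 ∘ₗ T k - T k ∘ₗ phi1 p.1) := by
  have hp : FR (p.1.2 ∘ₗ T k - T k ∘ₗ p.1.1) := p.2
  have : phi2 p.1 ∘ₗ T k - T k ∘ₗ phi1 p.1 =
    ((e' k).toLinearMap ∘ₗ LinearMap.inl k (W k) (M k)) ∘ₗ (p.1.2 ∘ₗ T k - T k ∘ₗ p.1.1) ∘ₗ
      (LinearMap.fst k (U k) (M k) ∘ₗ (e k).symm.toLinearMap) := by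
    apply LinearMap.ext; intro x
    obtain ⟨⟨x, m⟩, rfl⟩ := (e k).surjective x
    simp only [LinearMap.sub_apply, LinearMap.comp_apply, LinearEquiv.coe_coe,
      LinearEquiv.symm_apply_apply, LinearMap.fst_apply]
    rw [← e'_T, phi2_e, phi1_e, ← e'_T, ← map_sub]
    congr 1
    simp
  rw [this]
  exact (hp.comp_right _).comp_left _

theorem phi1_add (p q : Module.End k (U k) × Module.End k (W k)) :
    phi1 (p + q) = phi1 p + phi1 q := by
  apply ext_e; intro x m
  rw [LinearMap.add_apply, phi1_e, phi1_e, phi1_e, ← map_add, N_add]; rfl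
theorem phi2_add (p q : Module.End k (U k) × Module.End k (W k)) :
    phi2 (p + q) = phi2 p + phi2 q := by
  apply ext_e'; intro x m
  rw [LinearMap.add_apply, phi2_e, phi2_e, phi2_e, ← map_add, N_add]; rfl
theorem phi1_mul (p q : Module.End k (U k) × Module.End k (W k)) :
    phi1 (p * q) = phi1 p * phi1 q := by
  apply ext_e; intro x m
  rw [Module.End.mul_apply, phi1_e, phi1_e, phi1_e, N_mul]; rfl
theorem phi2_mul (p q : Module.End k (U k) × Module.End k (W k)) :
    phi2 (p * q) = phi2 p * phi2 q := by
  apply ext_e'; intro x m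
  rw [Module.End.mul_apply, phi2_e, phi2_e, phi2_e, N_mul]; rfl
theorem phi1_one :
    phi1 (1 : Module.End k (U k) × Module.End k (W k)) = 1 := by
  apply ext_e; intro x m
  rw [Module.End.one_apply, phi1_e, N_one]; rfl
theorem phi2_one :
    phi2 (1 : Module.End k (U k) × Module.End k (W k)) = 1 := by
  apply ext_e'; intro x m
  rw [Module.End.one_apply, phi2_e, N_one]; rfl
theorem phi1_smul (r : k) (p : Module.End k (U k) × Module.End k (W k)) :
    phi1 (r • p) = r • phi1 p := by
  apply ext_e; intro x m
  rw [LinearMap.smul_apply, phi1_e, phi1_e, ← map_smul, N_smul]; rfl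
theorem phi2_smul (r : k) (p : Module.End k (U k) × Module.End k (W k)) :
    phi2 (r • p) = r • phi2 p := by
  apply ext_e'; intro x m
  rw [LinearMap.smul_apply, phi2_e, phi2_e, ← map_smul, N_smul]; rfl

/-- the endomorphism as a function -/
noncomputable def phiF (p : P k) : P k := ⟨(phi1 p.1, phi2 p.1), phi_mem p⟩

/-- the endomorphism as a linear map -/
noncomputable def phiL : P k →ₗ[k] P k where
  toFun := phiF
  map_add' p q := Subtype.ext (Prod.ext (phi1_add p.1 q.1) (phi2_add p.1 q.1))
  map_smul' r p := Subtype.ext (Prod.ext (phi1_smul r p.1) (phi2_smul r p.1))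

/-- the endomorphism -/
noncomputable def phi : P k →ₐ[k] P k :=
  AlgHom.ofLinearMap phiL
    (Subtype.ext (Prod.ext phi1_one phi2_one))
    (fun p q => Subtype.ext (Prod.ext (phi1_mul p.1 q.1) (phi2_mul p.1 q.1)))

theorem phi_val (p : P k) : (phi p).1 = (phi1 p.1, phi2 p.1) := rfl

theorem exists_xy (p : P k) (hp : p ≠ 0) :
    ∃ (x : M k →ₗ[k] W k) (y : W k →ₗ[k] M k), ∀ w, x (N p.1 (y w)) = w := by
  have h0 : p.1.1.prodMap p.1.2 ≠ 0 := by
    intro h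
    apply hp
    apply Subtype.ext; apply Prod.ext
    · apply LinearMap.ext; intro x
      have := LinearMap.congr_fun h (x, 0)
      exact congrArg Prod.fst this
    · apply LinearMap.ext; intro x
      have := LinearMap.congr_fun h (0, x)
      exact congrArg Prod.snd this
  obtain ⟨z, hz⟩ : ∃ z, p.1.1.prodMap p.1.2 z ≠ 0 := by
    by_contra! h
    exact h0 (LinearMap.ext h)
  obtain ⟨l, hl⟩ := Module.Projective.exists_dual_eq_one k hz
  let y : (ℕ →₀ k) →ₗ[k] M k := Finsupp.mapRange.linearMap (LinearMap.toSpanSingleton k (U k × W k) z)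
  let x : M k →ₗ[k] (ℕ →₀ k) := Finsupp.mapRange.linearMap l
  have key : ∀ v, x (N p.1 (y v)) = v := by
    intro v
    ext n
    have h1 : N p.1 (y v) n = p.1.1.prodMap p.1.2 (v n • z) := by
      simp [N, y]
    have h2 : ∀ m, x m n = l (m n) := by intro m; simp [x]
    rw [h2, h1, map_smul, map_smul, hl, smul_eq_mul, mul_one]
  let w' : W k ≃ₗ[k] (ℕ →₀ k) := wu k
  refine ⟨w'.symm.toLinearMap ∘ₗ x, y ∘ₗ w'.toLinearMap, fun w => ?_⟩
  simp [key]

theorem P_full (p : P k) (hp : p ≠ 0) : ∃ x y : P k, x * phi p * y = 1 := by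
  obtain ⟨x, y, hxy⟩ := exists_xy p hp
  let y2 : Module.End k (W k) := (e' k).toLinearMap ∘ₗ LinearMap.inr k (W k) (M k) ∘ₗ y
  let y1 : Module.End k (U k) := (e k).toLinearMap ∘ₗ LinearMap.inr k (U k) (M k) ∘ₗ y ∘ₗ T k
  let x2 : Module.End k (W k) := x ∘ₗ LinearMap.snd k (W k) (M k) ∘ₗ (e' k).symm.toLinearMap
  let x1 : Module.End k (U k) := Ts k ∘ₗ x2 ∘ₗ T k
  have hT : ∀ m, T k (e k (0, m)) = e' k (0, m) := fun m => rfl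
  have hy : FR (y2 ∘ₗ T k - T k ∘ₗ y1) := by
    have : y2 ∘ₗ T k - T k ∘ₗ y1 = 0 := by
      apply LinearMap.ext; intro v
      rw [LinearMap.sub_apply, LinearMap.zero_apply, sub_eq_zero]
      show e' k (0, y (T k v)) = T k (e k (0, y (T k v)))
      rw [hT]
    rw [this]; exact FR.zero
  have hx : FR (x2 ∘ₗ T k - T k ∘ₗ x1) := by
    have : x2 ∘ₗ T k - T k ∘ₗ x1 = - ((T k ∘ₗ Ts k - LinearMap.id) ∘ₗ (x2 ∘ₗ T k)) := by
      apply LinearMap.ext; intro v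
      simp only [x1, LinearMap.sub_apply, LinearMap.neg_apply, LinearMap.comp_apply, LinearMap.id_apply]
      abel
    rw [this]; exact ((FR_TT k).comp_right _).neg
  have hx2 : ∀ w m, x2 (e' k (w, m)) = x m := by intro w m; simp [x2]
  refine ⟨⟨(x1, x2), hx⟩, ⟨(y1, y2), hy⟩, ?_⟩
  apply Subtype.ext; apply Prod.ext
  · apply LinearMap.ext; intro v
    show Ts k (x2 (T k (phi1 p.1 (e k (0, y (T k v)))))) = v
    rw [phi1_e, map_zero, hT, hx2, hxy]
    rfl
  · apply LinearMap.ext; intro v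
    show x2 (phi2 p.1 (e' k (0, y v))) = v
    rw [phi2_e, hx2, hxy]

theorem P_idem : ∃ p : P k, p * p = p ∧ p ≠ 0 ∧ p ≠ 1 := by
  refine ⟨⟨(0, LinearMap.inl k k (U k) ∘ₗ LinearMap.fst k k (U k)), ?_⟩, ?_, ?_, ?_⟩
  · show FR _
    have : (LinearMap.inl k k (U k) ∘ₗ LinearMap.fst k k (U k)) ∘ₗ T k - T k ∘ₗ (0 : Module.End k (U k)) = 0 := by
      ext <;> simp
    simp only [this]; exact FR.zero
  · apply Subtype.ext; apply Prod.ext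
    · simp
    · apply LinearMap.ext; intro v; simp
  · intro h
    have := congrArg (fun q : P k => (q.1.2 (1, 0)).1) h
    simp at this
  · intro h
    have := congrArg (fun q : P k => q.1.1) h
    have h5 := LinearMap.congr_fun this (Finsupp.single 0 1 : ℕ →₀ k)
    have h6 : (0 : ℕ →₀ k) = Finsupp.single 0 1 := h5
    have := DFunLike.congr_fun h6 0
    simp at this

end constr

section mat
variable {k : Type u} [Field k] {X : Type v} [AddCommGroup X] [Module k X]

/-- action of a matrix of endomorphisms -/
noncomputable def act {l m : ℕ} (A : Matrix (Fin m) (Fin l) (Module.End k X)) :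
    (Fin l → X) →ₗ[k] (Fin m → X) :=
  LinearMap.pi fun j => ∑ i, A j i ∘ₗ LinearMap.proj i

theorem act_apply {l m : ℕ} (A : Matrix (Fin m) (Fin l) (Module.End k X)) (v : Fin l → X)
    (j : Fin m) : act A v j = ∑ i, A j i (v i) := by
  simp [act, LinearMap.sum_apply]

theorem act_mul {l m n : ℕ} (A : Matrix (Fin m) (Fin l) (Module.End k X))
    (B : Matrix (Fin l) (Fin n) (Module.End k X)) (v : Fin n → X) :
    act (A * B) v = act A (act B v) := by
  funext j
  simp only [act_apply, Matrix.mul_apply, LinearMap.sum_apply, map_sum, Module.End.mul_apply]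
  rw [Finset.sum_comm]

theorem act_one {l : ℕ} (v : Fin l → X) :
    act (1 : Matrix (Fin l) (Fin l) (Module.End k X)) v = v := by
  funext j
  rw [act_apply, Finset.sum_eq_single j]
  · simp
  · intro i _ h; simp [Matrix.one_apply_ne h.symm]
  · simp

/-- matrices give equivalences -/
noncomputable def actEquiv {l m : ℕ} (A : Matrix (Fin m) (Fin l) (Module.End k X))
    (B : Matrix (Fin l) (Fin m) (Module.End k X)) (h1 : A * B = 1) (h2 : B * A = 1) :
    (Fin l → X) ≃ₗ[k] (Fin m → X) :=
  LinearEquiv.ofLinearMap (act A) (act B)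
    (by apply LinearMap.ext; intro v; simp only [LinearMap.comp_apply, ← act_mul, h1, act_one, LinearMap.id_apply])
    (by apply LinearMap.ext; intro v; simp only [LinearMap.comp_apply, ← act_mul, h2, act_one, LinearMap.id_apply])

/-- coordinatewise `T` -/
noncomputable def Tn (k : Type u) [Field k] (l : ℕ) : (Fin l → U k) →ₗ[k] (Fin l → W k) :=
  (T k).compLeft (Fin l)

theorem Tn_inj (l : ℕ) : Function.Injective (Tn k l) := by
  intro v w h
  funext i
  have := congrFun h i
  exact congrArg Prod.snd this

theorem Tn_codim (l : ℕ) : Module.rank k ((Fin l → W k) ⧸ LinearMap.range (Tn k l)) = l := by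
  let f : (Fin l → W k) →ₗ[k] (Fin l → k) := (LinearMap.fst k k (U k)).compLeft (Fin l)
  have hf : LinearMap.range (Tn k l) = LinearMap.ker f := by
    ext w
    constructor
    · rintro ⟨v, rfl⟩
      rw [LinearMap.mem_ker]; funext i; rfl
    · intro h
      refine ⟨fun i => (w i).2, ?_⟩
      funext i
      have : (w i).1 = 0 := congrFun h i
      exact Prod.ext this.symm rfl
  have hs : Function.Surjective f := fun g => ⟨fun i => (g i, 0), rfl⟩
  rw [hf, (f.quotKerEquivOfSurjective hs).rank_eq]
  simp

theorem P_ibn {l m : ℕ} (A : Matrix (Fin m) (Fin l) (P k)) (B : Matrix (Fin l) (Fin m) (P k))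
    (h1 : A * B = 1) (h2 : B * A = 1) : l = m := by
  let p1 : P k →+* Module.End k (U k) := (RingHom.fst _ _).comp (P k).val.toRingHom
  let p2 : P k →+* Module.End k (W k) := (RingHom.snd _ _).comp (P k).val.toRingHom
  let E1 := actEquiv (A.map p1) (B.map p1)
    (by rw [← Matrix.map_mul, h1]; simp) (by rw [← Matrix.map_mul, h2]; simp)
  let E2 := actEquiv (A.map p2) (B.map p2)
    (by rw [← Matrix.map_mul, h1]; simp) (by rw [← Matrix.map_mul, h2]; simp)
  have hE1 : ∀ v j, E1 v j = ∑ i, (A j i).1.1 (v i) := fun v j => act_apply _ v j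
  have hE2 : ∀ v j, E2 v j = ∑ i, (A j i).1.2 (v i) := fun v j => act_apply _ v j
  let F : (Fin l → U k) →ₗ[k] (Fin m → W k) := E2.toLinearMap ∘ₗ Tn k l
  let G : (Fin l → U k) →ₗ[k] (Fin m → W k) := Tn k m ∘ₗ E1.toLinearMap
  refine index_eq F G (E2.injective.comp (Tn_inj l)) ((Tn_inj m).comp E1.injective) ?_ l m ?_ ?_
  · have : F - G = ∑ j, ∑ i, LinearMap.single k (fun _ : Fin m => W k) j ∘ₗ
        ((A j i).1.2 ∘ₗ T k - T k ∘ₗ (A j i).1.1) ∘ₗ LinearMap.proj i := by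
      apply LinearMap.ext; intro v
      funext j
      have hF : F v j = ∑ i, (A j i).1.2 (T k (v i)) := hE2 _ j
      have hG : G v j = ∑ i, T k ((A j i).1.1 (v i)) := by
        have : G v j = T k (E1 v j) := rfl
        rw [this, hE1, map_sum]
      rw [LinearMap.sub_apply, Pi.sub_apply, hF, hG, ← Finset.sum_sub_distrib]
      simp only [LinearMap.sum_apply, Finset.sum_apply, LinearMap.comp_apply, LinearMap.single_apply]
      rw [Finset.sum_eq_single j]
      · simp
      · intro b _ hb
        apply Finset.sum_eq_zero; intro i _
        rw [Pi.single_eq_of_ne hb.symm]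
      · simp
    rw [this]
    refine FR.sum _ fun j => FR.sum _ fun i => ?_
    have hA : FR ((A j i).1.2 ∘ₗ T k - T k ∘ₗ (A j i).1.1) := (A j i).2
    exact (hA.comp_right _).comp_left _
  · have : LinearMap.range F = (LinearMap.range (Tn k l)).map E2.toLinearMap := LinearMap.range_comp _ _
    rw [this, ← Tn_codim (k := k) l]
    exact (Submodule.Quotient.equiv _ _ E2 rfl).rank_eq.symm
  · have : LinearMap.range G = LinearMap.range (Tn k m) :=
      LinearMap.range_comp_of_range_eq_top _ E1.range
    rw [this, Tn_codim]
end mat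

section lim
variable {k : Type u} [Field k] {A : Type u} [Ring A] [Algebra k A] (φ : A →ₐ[k] A)

/-- eventually coherent sequences -/
def B : Subalgebra k (ℕ → A) where
  carrier := {f | ∃ n, ∀ i, n ≤ i → f (i + 1) = φ (f i)}
  mul_mem' := by
    rintro f g ⟨n, hn⟩ ⟨m, hm⟩
    refine ⟨max n m, fun i hi => ?_⟩
    simp [hn i (le_of_max_le_left hi), hm i (le_of_max_le_right hi)]
  add_mem' := by
    rintro f g ⟨n, hn⟩ ⟨m, hm⟩
    refine ⟨max n m, fun i hi => ?_⟩
    simp [hn i (le_of_max_le_left hi), hm i (le_of_max_le_right hi)]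
  algebraMap_mem' r := ⟨0, fun i _ => by simp⟩

/-- eventually zero sequences -/
def J : Ideal (B φ) where
  carrier := {f | ∃ n, ∀ i, n ≤ i → f.1 i = 0}
  zero_mem' := ⟨0, fun i _ => rfl⟩
  add_mem' := by
    rintro f g ⟨n, hn⟩ ⟨m, hm⟩
    refine ⟨max n m, fun i hi => ?_⟩
    simp [hn i (le_of_max_le_left hi), hm i (le_of_max_le_right hi)]
  smul_mem' := by
    rintro c f ⟨n, hn⟩
    exact ⟨n, fun i hi => by simp [hn i hi]⟩

instance : (J φ).IsTwoSided where
  mul_mem_of_left := by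
    rintro f c ⟨n, hn⟩
    exact ⟨n, fun i hi => by simp [hn i hi]⟩

/-- the limit -/
def Lim := B φ ⧸ J φ
instance : Ring (Lim φ) := inferInstanceAs (Ring (B φ ⧸ J φ))
instance : Algebra k (Lim φ) := inferInstanceAs (Algebra k (B φ ⧸ J φ))

/-- quotient map -/
def mkL : B φ →+* Lim φ := Ideal.Quotient.mk (J φ)
theorem mkL_surj (s : Lim φ) : ∃ f, mkL φ f = s := Ideal.Quotient.mk_surjective (I := J φ) s

theorem mk_eq {f g : B φ} : (mkL φ f = mkL φ g) ↔
    ∃ n, ∀ i, n ≤ i → f.1 i = g.1 i := by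
  refine (Ideal.Quotient.eq (I := J φ)).trans ?_
  constructor
  · rintro ⟨n, hn⟩; exact ⟨n, fun i hi => sub_eq_zero.mp (hn i hi)⟩
  · rintro ⟨n, hn⟩; exact ⟨n, fun i hi => sub_eq_zero.mpr (hn i hi)⟩

/-- sequence starting at stage `n` -/
def seq (n : ℕ) (a : A) : B φ := ⟨fun i => (φ^[i - n]) a, n, fun i hi => by
  show (φ^[i + 1 - n]) a = φ ((φ^[i - n]) a)
  rw [Nat.sub_add_comm hi, Function.iterate_succ_apply']⟩

/-- element at stage `n` -/
def inc (n : ℕ) (a : A) : Lim φ := mkL φ (seq φ n a)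

theorem inc_mul (n : ℕ) (a b : A) : inc φ n (a * b) = inc φ n a * inc φ n b := by
  rw [inc, inc, inc, ← map_mul, mk_eq]
  exact ⟨0, fun i _ => iterate_map_mul φ _ _ _⟩

theorem inc_one (n : ℕ) : inc φ n (1 : A) = 1 := by
  rw [inc, ← map_one (mkL φ), mk_eq]
  exact ⟨0, fun i _ => iterate_map_one φ _⟩

theorem inc_zero (n : ℕ) : inc φ n (0 : A) = 0 := by
  rw [inc, ← map_zero (mkL φ), mk_eq]
  exact ⟨0, fun i _ => iterate_map_zero φ _⟩

theorem inc_succ (n : ℕ) (a : A) : inc φ (n + 1) (φ a) = inc φ n a := by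
  rw [inc, inc, mk_eq]
  refine ⟨n + 1, fun i hi => ?_⟩
  show (φ^[i - (n+1)]) (φ a) = (φ^[i - n]) a
  rw [← Function.iterate_succ_apply]
  congr 2; omega

theorem exists_inc (s : Lim φ) : ∃ n a, s = inc φ n a := by
  obtain ⟨f, rfl⟩ := mkL_surj φ s
  obtain ⟨n, hn⟩ := f.2
  refine ⟨n, f.1 n, ?_⟩
  rw [inc, mk_eq]
  refine ⟨n, fun i hi => ?_⟩
  obtain ⟨j, rfl⟩ := Nat.exists_eq_add_of_le hi
  show _ = (φ^[n + j - n]) (f.1 n)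
  rw [Nat.add_sub_cancel_left]
  induction j with
  | zero => rfl
  | succ j ih =>
    rw [Function.iterate_succ_apply', ← ih (by omega)]
    exact hn (n + j) (Nat.le_add_right n j)

theorem lim_mat {l m : ℕ} (X : Matrix (Fin m) (Fin l) (Lim φ)) (Y : Matrix (Fin l) (Fin m) (Lim φ))
    (h1 : X * Y = 1) (h2 : Y * X = 1) :
    ∃ (X' : Matrix (Fin m) (Fin l) A) (Y' : Matrix (Fin l) (Fin m) A), X' * Y' = 1 ∧ Y' * X' = 1 := by
  have aux : ∀ {a b : ℕ} (X : Matrix (Fin a) (Fin b) (B φ)) (Y : Matrix (Fin b) (Fin a) (B φ)),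
      (X.map (mkL φ) * Y.map (mkL φ) = 1) →
      ∃ n, ∀ i, n ≤ i → (X.map fun f => f.1 i) * (Y.map fun f => f.1 i) = 1 := by
    intro a b X Y h
    have h' : ∀ p q, ∃ n, ∀ i, n ≤ i → ((X * Y) p q).1 i = ((1 : Matrix (Fin a) (Fin a) (B φ)) p q).1 i := by
      intro p q
      rw [← mk_eq]
      rw [← Matrix.map_mul] at h
      have := congrFun (congrFun h p) q
      rw [Matrix.map_apply] at this
      rw [this]
      by_cases hpq : p = q
      · subst hpq; simp
      · simp [Matrix.one_apply_ne hpq]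
    choose n hn using h'
    refine ⟨Finset.univ.sup fun p => Finset.univ.sup fun q => n p q, fun i hi => ?_⟩
    ext p q
    have hle : n p q ≤ i := by
      refine le_trans ?_ hi
      refine le_trans ?_ (Finset.le_sup (Finset.mem_univ p))
      exact Finset.le_sup (f := fun q => n p q) (Finset.mem_univ q)
    let ev : B φ →+* A := (Pi.evalRingHom (fun _ : ℕ => A) i).comp (B φ).val.toRingHom
    have := hn p q i hle
    have e1 : (X.map fun f => f.1 i) * (Y.map fun f => f.1 i) = (X * Y).map ev := by
      rw [Matrix.map_mul]; rfl
    rw [e1, Matrix.map_apply]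
    refine this.trans ?_
    by_cases hpq : p = q
    · subst hpq; simp
    · simp [Matrix.one_apply_ne hpq]
  choose r hr using fun s : Lim φ => mkL_surj φ s
  have e : ∀ {a b : ℕ} (X : Matrix (Fin a) (Fin b) (Lim φ)),
    (X.map r).map (mkL φ) = X := by
    intro a b X; ext p q; simp [hr]
  obtain ⟨n, hn⟩ := aux (X.map r) (Y.map r) (by rw [e, e, h1])
  obtain ⟨n', hn'⟩ := aux (Y.map r) (X.map r) (by rw [e, e, h2])
  exact ⟨_, _, hn _ (le_max_left n n'), hn' _ (le_max_right n n')⟩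
end lim

section gen
variable {S : Type u} [Ring S]

theorem pis (hf : ∀ a : S, a ≠ 0 → ∃ x y, x * a * y = 1) (ε : S) (h1 : ε * ε = ε) (h2 : ε ≠ 0)
    (h3 : ε ≠ 1) : PurelyInfiniteSimple S := by
  have : Nontrivial S := ⟨_, _, h2⟩
  refine ⟨⟨⟨fun I => ?_⟩⟩, fun I hI => ?_⟩
  · by_cases h : I = ⊥
    · exact Or.inl h
    right
    obtain ⟨a, ha, ha0⟩ : ∃ a ∈ I, a ≠ 0 := by
      by_contra! hc
      apply h
      rw [eq_bot_iff]
      intro a ha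
      exact (TwoSidedIdeal.mem_bot S).mpr (hc a ha)
    obtain ⟨x, y, hxy⟩ := hf a ha0
    have : (1 : S) ∈ I := by
      rw [← hxy]; exact I.mul_mem_right _ _ (I.mul_mem_left _ _ ha)
    rw [eq_top_iff]
    intro z _
    have := I.mul_mem_left z _ this
    rwa [mul_one] at this
  · obtain ⟨a, ha, ha0⟩ := (Submodule.ne_bot_iff I).mp hI
    obtain ⟨x, y, hxy⟩ := hf a ha0
    obtain ⟨s, y', hs⟩ := hf ε h2
    let t := ε * y'
    have hst : s * t = 1 := by rw [← hs, mul_assoc]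
    have hts : 1 - t * s ≠ 0 := by
      intro h
      apply h3
      have h4 : t * s = 1 := (sub_eq_zero.mp h).symm
      calc ε = ε * (t * s) := by rw [h4, mul_one]
        _ = ε * ε * y' * s := by simp only [t, mul_assoc]
        _ = t * s := by rw [h1]
        _ = 1 := h4
    let A := a * y
    have hxA : x * A = 1 := by rw [← hxy, mul_assoc]
    have hxA' : ∀ z, x * (A * z) = z := fun z => by rw [← mul_assoc, hxA, one_mul]
    have hst' : ∀ z, s * (t * z) = z := fun z => by rw [← mul_assoc, hst, one_mul]
    have hmem : A * x ∈ I := by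
      have := I.smul_mem (MulOpposite.op (y * x)) ha
      rw [MulOpposite.smul_eq_mul_unop, MulOpposite.unop_op, ← mul_assoc] at this
      exact this
    clear_value A t
    refine ⟨A * x, hmem, ?_, A * t * s * x, A * (1 - t * s) * x, ?_, ?_, ?_, ?_, ?_, ?_, ?_⟩
    · simp only [IsIdempotentElem, mul_assoc, hxA']
    · simp only [IsIdempotentElem, mul_assoc, hxA', hst']
    · simp only [IsIdempotentElem, mul_assoc, hxA', hst', mul_sub, sub_mul, one_mul, sub_self, sub_zero]
    · simp only [mul_assoc, hxA', hst', mul_sub, sub_mul, one_mul, sub_self]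
    · simp only [mul_assoc, hxA', hst', mul_sub, sub_mul, one_mul, sub_self]
    · simp only [mul_assoc, mul_sub, sub_mul, one_mul]; abel
    · intro h
      apply hts
      have h5 : x * (A * (1 - t * s) * x) * A = 0 := by rw [h]; simp
      simpa only [mul_assoc, hxA', hxA, mul_one] using h5
    · refine ⟨A * s * x, A * t * x, ?_, ?_, ?_, ?_⟩ <;>
        simp only [mul_assoc, hxA', hst']

theorem mats {l m : ℕ} (f : (Fin l → S) ≃ₗ[Sᵐᵒᵖ] (Fin m → S)) :
    ∃ (X : Matrix (Fin m) (Fin l) S) (Y : Matrix (Fin l) (Fin m) S), X * Y = 1 ∧ Y * X = 1 := by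
  have key : ∀ {a b : ℕ} (f : (Fin a → S) →ₗ[Sᵐᵒᵖ] (Fin b → S)) (v : Fin a → S) (j : Fin b),
      f v j = ∑ i, f (Pi.single i 1) j * v i := by
    intro a b f v j
    have : v = ∑ i, MulOpposite.op (v i) • (Pi.single i 1 : Fin a → S) := by
      funext j
      rw [Finset.sum_apply, Finset.sum_eq_single j]
      · simp
      · intro i _ h; simp [Pi.single_eq_of_ne h.symm]
      · simp
    conv_lhs => rw [this, map_sum]
    simp [Finset.sum_apply]
  refine ⟨Matrix.of fun j i => f (Pi.single i 1) j, Matrix.of fun i j => f.symm (Pi.single j 1) i, ?_, ?_⟩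
  · ext p q
    rw [Matrix.mul_apply]
    refine (key f.toLinearMap (f.symm (Pi.single q 1)) p).symm.trans ?_
    simp [Matrix.one_apply, Pi.single_apply]
  · ext p q
    rw [Matrix.mul_apply]
    refine (key f.symm.toLinearMap (f (Pi.single q 1)) p).symm.trans ?_
    simp [Matrix.one_apply, Pi.single_apply]
end gen

theorem main (k : Type u) [Field k] :
    ∃ (S : Type u) (_ : Ring S) (_ : Algebra k S),
      (∀ a : S, ∃ b : S, a * b * a = a) ∧
      PurelyInfiniteSimple S ∧
      (∀ ℓ m : ℕ, 1 ≤ ℓ → 1 ≤ m →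
        (Nonempty ((Fin ℓ → S) ≃ₗ[Sᵐᵒᵖ] (Fin m → S)) ↔ ℓ = m)) := by
  let φ : P k →ₐ[k] P k := phi
  have hnt : Nontrivial (P k) := by
    obtain ⟨p, _, h, _⟩ := P_idem (k := k)
    exact ⟨_, _, h⟩
  have hinj : Function.Injective φ := by
    rw [injective_iff_map_eq_zero]
    intro a ha
    by_contra h
    obtain ⟨x, y, hxy⟩ := P_full a h
    have ha : phi a = 0 := ha
    rw [ha, mul_zero, zero_mul] at hxy
    exact zero_ne_one hxy
  have hinc : ∀ a b : P k, inc φ 0 a = inc φ 0 b → a = b := by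
    intro a b h
    rw [inc, inc, mk_eq] at h
    obtain ⟨n, hn⟩ := h
    exact (hinj.iterate (n - 0)) (hn n le_rfl)
  refine ⟨Lim φ, inferInstance, inferInstance, ?_, ?_, ?_⟩
  · intro s
    obtain ⟨n, a, rfl⟩ := exists_inc φ s
    obtain ⟨b, hb⟩ := P_reg a
    exact ⟨inc φ n b, by rw [← inc_mul, ← inc_mul, hb]⟩
  · obtain ⟨p, h1, h2, h3⟩ := P_idem (k := k)
    refine pis ?_ (inc φ 0 p) (by rw [← inc_mul, h1]) ?_ ?_
    · intro s hs
      obtain ⟨n, a, rfl⟩ := exists_inc φ s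
      have ha : a ≠ 0 := by rintro rfl; exact hs (inc_zero φ n)
      obtain ⟨x, y, hxy⟩ := P_full a ha
      refine ⟨inc φ (n+1) x, inc φ (n+1) y, ?_⟩
      rw [← inc_succ φ n a, ← inc_mul, ← inc_mul, ← inc_one φ (n+1)]
      exact congrArg _ hxy
    · intro h; exact h2 (hinc _ _ (h.trans (inc_zero φ 0).symm))
    · intro h; exact h3 (hinc _ _ (h.trans (inc_one φ 0).symm))
  · intro l m _ _
    constructor
    · rintro ⟨f⟩
      obtain ⟨X, Y, h1, h2⟩ := mats f
      obtain ⟨X', Y', h1, h2⟩ := lim_mat φ X Y h1 h2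
      exact P_ibn X' Y' h1 h2
    · rintro rfl
      exact ⟨LinearEquiv.refl _ _⟩

end PIS

/-- For every field `k` there is a `k`-algebra `S` which is von
Neumann regular, purely infinite simple, and such that `S^ℓ ≅ S^m` (as right
`S`-modules) iff `ℓ = m` for all `ℓ, m ≥ 1`. -/
theorem stmt16 (k : Type u) [Field k] :
    ∃ (S : Type u) (_ : Ring S) (_ : Algebra k S),
      (∀ a : S, ∃ b : S, a * b * a = a) ∧
      PurelyInfiniteSimple S ∧
      (∀ ℓ m : ℕ, 1 ≤ ℓ → 1 ≤ m →
        (Nonempty ((Fin ℓ → S) ≃ₗ[Sᵐᵒᵖ] (Fin m → S)) ↔ ℓ = m)) := by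
  exact PIS.main k
end

section
/- Let R be a ring such that every finitely generated submodule of a finitely generated free left R-module is projective (R is left semihereditary). Then every finitely presented right R-module M admits a direct sum decomposition M = M₁ ⊕ M₂ in which M₁ is a finitely generated projective right R-module and M₂ satisfies Hom_R(M₂, R) = 0, i.e., every homomorphism of right R-modules from M₂ to R is zero. -/
universe u

open MulOpposite in
/-- If `R` is left semihereditary (every finitely generated submodule
of a finitely generated free left `R`-module is projective), then every finitely
presented right `R`-module `M` decomposes as `M = M₁ ⊕ M₂` with `M₁` finitely generated
projective and `Hom_R(M₂, R) = 0`. -/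
theorem stmt17 {R : Type u} [Ring R]
    (hsh : ∀ (m : ℕ) (N : Submodule R (Fin m → R)), N.FG → Module.Projective R ↥N)
    (M : Type u) [AddCommGroup M] [Module Rᵐᵒᵖ M] [Module.FinitePresentation Rᵐᵒᵖ M] :
    ∃ M₁ M₂ : Submodule Rᵐᵒᵖ M, IsCompl M₁ M₂ ∧
      Module.Finite Rᵐᵒᵖ ↥M₁ ∧ Module.Projective Rᵐᵒᵖ ↥M₁ ∧
      (∀ f : M₂ →ₗ[Rᵐᵒᵖ] R, f = 0) := by
  classical
  obtain ⟨n, K, eqv, hK⟩ := Module.FinitePresentation.exists_fin Rᵐᵒᵖ M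
  obtain ⟨m, t, ht⟩ := Submodule.fg_iff_exists_fin_generating_family.mp hK
  let φ : (Fin n → R) →ₗ[R] (Fin m → R) :=
    { toFun := fun x k => ∑ i, x i * unop (t k i)
      map_add' := fun x y => by
        ext k; simp [add_mul, Finset.sum_add_distrib]
      map_smul' := fun r x => by
        ext k; simp [mul_assoc, Finset.mul_sum] }
  have hproj : Module.Projective R (LinearMap.range φ) := by
    apply hsh
    rw [LinearMap.range_eq_map]
    exact Submodule.FG.map _ Module.Finite.fg_top
  obtain ⟨s, hs⟩ := Module.projective_lifting_property φ.rangeRestrict LinearMap.id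
    φ.surjective_rangeRestrict
  have hs' : ∀ y, φ (s y) = y := fun y => by
    have := congrArg Subtype.val (LinearMap.congr_fun hs y)
    simpa using this
  let P : (Fin n → R) →ₗ[R] (Fin n → R) := LinearMap.id - s ∘ₗ φ.rangeRestrict
  have hP1 : ∀ x, φ (P x) = 0 := fun x => by
    simp [P, map_sub, hs']
  have hP2 : ∀ x, φ x = 0 → P x = x := fun x hx => by
    have : φ.rangeRestrict x = 0 := Subtype.ext hx
    simp [P, this]
  have hPsum : ∀ x j, P x j = ∑ i, x i * P (Pi.single i 1) j := fun x j => by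
    conv_lhs => rw [pi_eq_sum_univ' x]
    rw [map_sum, Finset.sum_apply]
    refine Finset.sum_congr rfl fun i _ => ?_
    rw [map_smul, Pi.smul_apply, smul_eq_mul]
  let E : (Fin n → Rᵐᵒᵖ) →ₗ[Rᵐᵒᵖ] (Fin n → Rᵐᵒᵖ) :=
    { toFun := fun v i => ∑ j, v j * op (P (Pi.single i 1) j)
      map_add' := fun x y => by
        ext k; simp [add_mul, Finset.sum_add_distrib]
      map_smul' := fun r x => by
        ext k; simp [mul_assoc, Finset.mul_sum] }
  have hE : ∀ v i, unop (E v i) = ∑ j, P (Pi.single i 1) j * unop (v j) := fun v i => by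
    simp [E]
  -- row times E
  have hrow : ∀ (x : Fin n → R) v, ∑ i, x i * unop (E v i) = ∑ j, P x j * unop (v j) := by
    intro x v
    simp_rw [hE, hPsum x, Finset.mul_sum, Finset.sum_mul]
    rw [Finset.sum_comm]
    simp [mul_assoc]
  have hEE : ∀ v, E (E v) = E v := fun v => by
    funext i
    apply unop_injective
    rw [hE, hrow, hP2 _ (hP1 _), hE]
  have hEK : K ≤ LinearMap.ker E := by
    rw [← ht, Submodule.span_le]
    rintro _ ⟨k, rfl⟩
    rw [SetLike.mem_coe, LinearMap.mem_ker]
    funext i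
    apply unop_injective
    rw [hE]
    exact congrFun (hP1 (Pi.single i 1)) k
  let π : (Fin n → Rᵐᵒᵖ) →ₗ[Rᵐᵒᵖ] M := eqv.symm.toLinearMap ∘ₗ K.mkQ
  have hπ : Function.Surjective π := eqv.symm.surjective.comp K.mkQ_surjective
  let e : M →ₗ[Rᵐᵒᵖ] (Fin n → Rᵐᵒᵖ) := K.liftQ E hEK ∘ₗ eqv.toLinearMap
  have heπ : ∀ v, e (π v) = E v := fun v => by simp [e, π]
  have hπK : ∀ k, π (t k) = 0 := fun k => by
    have : t k ∈ K := ht ▸ Submodule.subset_span ⟨k, rfl⟩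
    simp [π, this]
  let ε : M →ₗ[Rᵐᵒᵖ] M := π ∘ₗ e
  have hε : ∀ x, ε (ε x) = ε x := fun x => by
    obtain ⟨v, rfl⟩ := hπ x
    simp only [ε, LinearMap.comp_apply, heπ, hEE]
  have hidem : IsIdempotentElem ε := LinearMap.ext hε
  refine ⟨LinearMap.range ε, LinearMap.ker ε, ?_, ?_, ?_, ?_⟩
  · exact (LinearMap.IsIdempotentElem.isCompl hidem)
  · infer_instance
  · refine Module.Projective.of_split (e ∘ₗ (LinearMap.range ε).subtype)
      (ε.rangeRestrict ∘ₗ π) ?_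
    ext ⟨_, y, rfl⟩
    change ε (ε (ε y)) = ε y
    rw [hε, hε]
  · intro f
    let q : M →ₗ[Rᵐᵒᵖ] LinearMap.ker ε :=
      (LinearMap.id - ε).codRestrict _ fun x => by simp [hε]
    let g : M →ₗ[Rᵐᵒᵖ] R := f ∘ₗ q
    let x : Fin n → R := fun i => g (π (Pi.single i 1))
    have hx : ∀ v, g (π v) = ∑ i, x i * unop (v i) := fun v => by
      conv_lhs => rw [pi_eq_sum_univ' v]
      rw [map_sum, map_sum]
      refine Finset.sum_congr rfl fun i _ => ?_
      rw [map_smul, map_smul, ← op_unop (v i), op_smul_eq_mul]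
      simp only [x, unop_op]
    have hφx : φ x = 0 := by
      ext k
      change ∑ i, x i * unop (t k i) = 0
      rw [← hx, hπK, map_zero]
    ext ⟨y, hy⟩
    have h1 : g y = f ⟨y, hy⟩ := by
      change f (q y) = _
      congr 1
      ext
      simpa [q] using hy
    have h2 : g (ε y) = g y := by
      obtain ⟨v, rfl⟩ := hπ y
      change g (π (e (π v))) = _
      rw [heπ, hx, hx, hrow, hP2 _ hφx]
    rw [← h1, ← h2, LinearMap.mem_ker.mp hy, map_zero, LinearMap.zero_apply]
end

section
/- Let k be a field, n ≥ 1 an integer, and R = k⟨x_0, x_1, …, x_n⟩ the free k-algebra on n+1 generators. Let X, Y, Z be finitely generated projective right R-modules, let f : X → Y be an injective homomorphism of right R-modules whose cokernel Y/f(X) is finite-dimensional as a k-vector space, and let g : Z → Y be a homomorphism of right R-modules. Then there exist a finitely generated free right R-module P, an injective homomorphism of right R-modules f' : P → Z whose cokernel Z/f'(P) is finite-dimensional over k, and a homomorphism of right R-modules g' : P → X such that g ∘ f' = f ∘ g'. -/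
universe u

namespace OreAux

theorem exists_order (ι I : Type*) : ∃ r : ι × List I → ι × List I → Prop, IsWellOrder _ r ∧
    ∀ (w : List I) (i j : ι) (u v : List I), r (i, u) (j, v) → r (i, w ++ u) (j, w ++ v) := by
  obtain ⟨_, hι⟩ := exists_wellFoundedLT ι
  obtain ⟨_, hI⟩ := exists_wellFoundedLT I
  let s : List I → List I → Prop := List.Shortlex (· < ·)
  have hs : IsWellOrder _ s :=
    { trichotomous := (List.Shortlex.trichotomous (r := ((· < ·) : I → I → Prop))).trichotomous
      wf := List.Shortlex.wf hI.wf }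
  have h2 : IsWellOrder _ (Prod.Lex s ((· < ·) : ι → ι → Prop)) := inferInstance
  refine ⟨InvImage (Prod.Lex s ((· < ·) : ι → ι → Prop)) Prod.swap, ?_, ?_⟩
  · exact { trichotomous := (InvImage.trichotomous Prod.swap_injective).trichotomous
            wf := InvImage.wf _ h2.wf }
  · intro w i j u v h
    simp only [InvImage, Prod.swap, Prod.lex_def] at h ⊢
    rcases h with h | ⟨h, h'⟩
    · exact Or.inl (List.Shortlex.append_left h w)
    · exact Or.inr ⟨by rw [h], h'⟩

section lin
variable {k M T J : Type*} [Field k] [AddCommGroup M] [Module k M] [LinearOrder T]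

/-- `t` is the leading index of `m` -/
def IsLead (γ : Module.Basis T k M) (m : M) (t : T) : Prop :=
  γ.repr m t ≠ 0 ∧ ∀ s, γ.repr m s ≠ 0 → s ≤ t

theorem exists_lead (γ : Module.Basis T k M) (m : M) (hm : m ≠ 0) : ∃ t, IsLead γ m t := by
  have h : (γ.repr m).support.Nonempty := by
    rw [Finsupp.support_nonempty_iff]
    simpa using hm
  refine ⟨(γ.repr m).support.max' h, ?_, ?_⟩
  · exact Finsupp.mem_support_iff.1 (Finset.max'_mem _ h)
  · intro s hs
    exact Finset.le_max' _ _ (Finsupp.mem_support_iff.2 hs)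

theorem lin_indep (γ : Module.Basis T k M) (φ : J → T) (hφ : Function.Injective φ) (e : J → M)
    (he : ∀ j, IsLead γ (e j) (φ j)) : LinearIndependent k e := by
  rw [linearIndependent_iff]
  intro l hl
  by_contra hne
  obtain ⟨j, hj, hmax⟩ := Finset.exists_max_image l.support φ (Finsupp.support_nonempty_iff.2 hne)
  have h0 : γ.repr (Finsupp.linearCombination k e l) (φ j) = 0 := by rw [hl]; simp
  rw [Finsupp.linearCombination_apply, Finsupp.sum, map_sum, Finsupp.finsetSum_apply,
    Finset.sum_eq_single j] at h0
  · simp only [map_smul, Finsupp.smul_apply, smul_eq_mul, mul_eq_zero] at h0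
    exact h0.elim (Finsupp.mem_support_iff.1 hj) (he j).1
  · intro i hi hij
    have : γ.repr (e i) (φ j) = 0 := by
      by_contra h
      exact hij (hφ (le_antisymm (hmax i hi) ((he i).2 _ h)))
    simp [this]
  · intro h; exact absurd hj h

theorem span_mem [WellFoundedLT T] (γ : Module.Basis T k M) (φ : J → T) (e : J → M)
    (he : ∀ j, IsLead γ (e j) (φ j)) (V : Submodule k M) (hV : ∀ j, e j ∈ V)
    (hL : ∀ v ∈ V, ∀ t, IsLead γ v t → ∃ j, φ j = t) (v : M) (hv : v ∈ V) :
    v ∈ Submodule.span k (Set.range e) := by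
  have key : ∀ t, ∀ v ∈ V, IsLead γ v t → v ∈ Submodule.span k (Set.range e) := by
    intro t
    induction t using WellFoundedLT.induction with
    | ind t ih =>
      intro v hv hvt
      obtain ⟨j, rfl⟩ := hL v hv t hvt
      set c := γ.repr v (φ j) / γ.repr (e j) (φ j) with hc
      have hmem : c • e j ∈ Submodule.span k (Set.range e) :=
        Submodule.smul_mem _ _ (Submodule.subset_span ⟨j, rfl⟩)
      suffices h : v - c • e j ∈ Submodule.span k (Set.range e) by
        simpa using Submodule.add_mem _ h hmem
      by_cases h0 : v - c • e j = 0
      · rw [h0]; exact Submodule.zero_mem _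
      obtain ⟨s, hs⟩ := exists_lead γ _ h0
      refine ih s ?_ _ (V.sub_mem hv (V.smul_mem _ (hV j))) hs
      have h1 : γ.repr (v - c • e j) s ≠ 0 := hs.1
      rw [map_sub, map_smul, Finsupp.sub_apply, Finsupp.smul_apply, smul_eq_mul] at h1
      refine lt_of_le_of_ne ?_ ?_
      · by_contra hlt
        apply h1
        have a1 : γ.repr v s = 0 := by
          by_contra h; exact hlt (hvt.2 _ h)
        have a2 : γ.repr (e j) s = 0 := by
          by_contra h; exact hlt ((he j).2 _ h)
        simp [a1, a2]
      · rintro rfl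
        apply h1
        rw [hc, div_mul_cancel₀ _ (he j).1, sub_self]
  by_cases h0 : v = 0
  · rw [h0]; exact Submodule.zero_mem _
  obtain ⟨t, ht⟩ := exists_lead γ _ h0
  exact key t v hv ht

end lin

theorem free_sub {k A I : Type*} [Field k] [Ring A] [Algebra k A]
    (β : Module.Basis (List I) k A) (hβ : ∀ u v, β (u ++ v) = β u * β v) (ι : Type*)
    (K : Submodule A (ι →₀ A)) : Module.Free A K := by
  classical
  obtain ⟨r, hr, hcomp⟩ := exists_order ι I
  let : LinearOrder (ι × List I) := linearOrderOfSTO r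
  have : WellFoundedLT (ι × List I) := ⟨hr.wf⟩
  have hcomp' : ∀ (w : List I) (p q : ι × List I), p ≤ q → (p.1, w ++ p.2) ≤ (q.1, w ++ q.2) := by
    intro w p q h
    rcases h.eq_or_lt with h | h
    · rw [h]
    · exact le_of_lt (hcomp w p.1 q.1 p.2 q.2 h)
  let γ : Module.Basis (ι × List I) k (ι →₀ A) :=
    (Finsupp.basis fun _ => β).reindex (Equiv.sigmaEquivProd ι (List I))
  have hγ : ∀ i u, γ (i, u) = Finsupp.single i (β u) := by
    intro i u
    simp [γ, Finsupp.coe_basis]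
  have hrepr : ∀ (w : List I) (m : ι →₀ A), γ.repr (β w • m) =
      (γ.repr m).mapDomain (fun p => (p.1, w ++ p.2)) := by
    intro w m
    have : γ.repr.toLinearMap ∘ₗ (Algebra.lsmul k k (ι →₀ A) (β w)) =
        (Finsupp.lmapDomain k k (fun p : ι × List I => (p.1, w ++ p.2))) ∘ₗ γ.repr.toLinearMap := by
      apply γ.ext
      rintro ⟨i, u⟩
      have : β w • γ (i, u) = γ (i, w ++ u) := by
        rw [hγ, hγ, hβ, Finsupp.smul_single, smul_eq_mul]
      simp [this]
    exact LinearMap.congr_fun this m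
  have hinj : ∀ w : List I, Function.Injective (fun p : ι × List I => (p.1, w ++ p.2)) := by
    rintro w ⟨i, u⟩ ⟨j, v⟩ h
    simpa using h
  have hlead : ∀ (w : List I) m p, IsLead γ m p → IsLead γ (β w • m) (p.1, w ++ p.2) := by
    intro w m p hp
    refine ⟨?_, ?_⟩
    · rw [hrepr]
      have := Finsupp.mapDomain_apply (hinj w) (γ.repr m) p
      rw [this]; exact hp.1
    · intro s hs
      rw [hrepr] at hs
      have := Finsupp.mapDomain_support (Finsupp.mem_support_iff.2 hs)
      obtain ⟨q, hq, rfl⟩ := Finset.mem_image.1 this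
      exact hcomp' w q p (hp.2 q (Finsupp.mem_support_iff.1 hq))
  let L : Set (ι × List I) := {p | ∃ m ∈ K, IsLead γ m p}
  let B : Set (ι × List I) := {p | p ∈ L ∧ ∀ w u, p.2 = w ++ u → (p.1, u) ∈ L → w = []}
  have hB : ∀ b : B, ∃ m ∈ K, IsLead γ m b.1 := fun b => b.2.1
  choose m hmK hm using hB
  let φ : (Σ _ : B, List I) → ι × List I := fun j => (j.1.1.1, j.2 ++ j.1.1.2)
  let e : (Σ _ : B, List I) → (ι →₀ A) := fun j => β j.2 • m j.1
  have he : ∀ j, IsLead γ (e j) (φ j) := fun j => hlead _ _ _ (hm j.1)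
  have hφ : Function.Injective φ := by
    rintro ⟨⟨⟨i, u⟩, hb⟩, w⟩ ⟨⟨⟨j, v⟩, hc⟩, w'⟩ h
    simp only [φ, Prod.mk.injEq] at h
    obtain ⟨rfl, h⟩ := h
    rcases List.append_eq_append_iff.1 h with ⟨a, h1, h2⟩ | ⟨a, h1, h2⟩
    · have := hb.2 a v h2 hc.1
      subst this
      simp at h1 h2
      subst h1 h2; rfl
    · have := hc.2 a u h2 hb.1
      subst this
      simp at h1 h2
      subst h1 h2; rfl
  have hsurj : ∀ v ∈ K, ∀ t, IsLead γ v t → ∃ j, φ j = t := by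
    have : ∀ N : ℕ, ∀ i u, List.length u ≤ N → (i, u) ∈ L → ∃ j, φ j = (i, u) := by
      intro N
      induction N with
      | zero =>
        intro i u hu hL
        have hu : u = [] := List.length_eq_zero_iff.1 (by omega)
        subst hu
        refine ⟨⟨⟨(i, []), hL, ?_⟩, []⟩, rfl⟩
        intro w u h _
        simp at h; exact h.1
      | succ N ih =>
        intro i u hu hL
        by_cases hb : (i, u) ∈ B
        · exact ⟨⟨⟨(i, u), hb⟩, []⟩, rfl⟩
        · simp only [B, Set.mem_ofPred_eq, not_and, not_forall] at hb
          obtain ⟨w, u', h1, h2, h3⟩ := hb hL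
          subst h1
          have : 0 < w.length := List.length_pos_iff.2 h3
          rw [List.length_append] at hu
          obtain ⟨⟨b, w'⟩, hj⟩ := ih i u' (by omega) h2
          refine ⟨⟨b, w ++ w'⟩, ?_⟩
          simp only [φ, Prod.mk.injEq] at hj ⊢
          rw [List.append_assoc, hj.2]
          exact ⟨hj.1, rfl⟩
    intro v hv t ht
    exact this _ t.1 t.2 le_rfl ⟨v, hv, ht⟩
  have heK : ∀ j, e j ∈ K := fun j => K.smul_mem _ (hmK _)
  have hli := lin_indep γ φ hφ e he
  have hsp := span_mem γ φ e he (K.restrictScalars k) heK hsurj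
  have hA : LinearIndependent A m := by
    let δ : Module.Basis (Σ _ : B, List I) k (B →₀ A) := Finsupp.basis fun _ => β
    have h1 : (Finsupp.linearCombination A m).restrictScalars k =
        Finsupp.linearCombination k e ∘ₗ δ.repr.toLinearMap := by
      apply δ.ext
      rintro ⟨b, w⟩
      have h3 : δ ⟨b, w⟩ = Finsupp.single b (β w) := by simp [δ, Finsupp.coe_basis]
      have h4 : Finsupp.linearCombination A m (δ ⟨b, w⟩) = e ⟨b, w⟩ := by
        rw [h3, Finsupp.linearCombination_single]
      simp [h4]
    change Function.Injective (Finsupp.linearCombination A m)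
    have h2 : Function.Injective (Finsupp.linearCombination k e ∘ₗ δ.repr.toLinearMap) :=
      by
      have h5 : Function.Injective (Finsupp.linearCombination k e) := hli
      exact h5.comp δ.repr.injective
    rw [← h1] at h2
    exact h2
  have hspan : Submodule.span A (Set.range m) = K := by
    apply le_antisymm
    · rw [Submodule.span_le]
      rintro _ ⟨b, rfl⟩
      exact hmK b
    · intro v hv
      have h := hsp v hv
      have : Submodule.span k (Set.range e) ≤ (Submodule.span A (Set.range m)).restrictScalars k := by
        rw [Submodule.span_le]
        rintro _ ⟨j, rfl⟩
        exact Submodule.smul_mem _ _ (Submodule.subset_span (Set.mem_range_self j.1))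
      exact this h
  rw [← hspan]
  exact Module.Free.of_basis (Module.Basis.span hA)

theorem fg_of_cofinite {k A Z : Type*} [Field k] [Ring A] [Algebra k A] [AddCommGroup Z]
    [Module A Z] [Module k Z] [IsScalarTower k A Z] [hA : Algebra.FiniteType k A]
    [hZ : Module.Finite A Z] (K : Submodule A Z) (hK : FiniteDimensional k (Z ⧸ K)) : K.FG := by
  obtain ⟨X, hX⟩ := hA.1
  obtain ⟨S, hS⟩ := hZ.1
  -- complement
  obtain ⟨C, hC⟩ := Submodule.exists_isCompl (K.restrictScalars k)
  have : FiniteDimensional k (Z ⧸ K.restrictScalars k) :=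
    Module.Finite.equiv (Submodule.Quotient.restrictScalarsEquiv k K).symm
  have : FiniteDimensional k C :=
    Module.Finite.equiv (Submodule.quotientEquivOfIsCompl (K.restrictScalars k) C hC)
  let V : Submodule k Z := Submodule.span k (S : Set Z) ⊔ C
  have : FiniteDimensional k (Submodule.span k (S : Set Z)) := FiniteDimensional.span_finset k S
  let W : Submodule k Z := V ⊔ X.sup (fun x => V.map (Algebra.lsmul k k Z x))
  have hW : FiniteDimensional k W := by
    have : FiniteDimensional k ↥(X.sup (fun x => V.map (Algebra.lsmul k k Z x))) :=
      Submodule.finiteDimensional_finset_sup _ _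
    infer_instance
  let U : Submodule k Z := W ⊓ K.restrictScalars k
  have : FiniteDimensional k U := Submodule.finiteDimensional_of_le (inf_le_left : U ≤ W)
  obtain ⟨G, hG⟩ := (Submodule.fg_iff_finiteDimensional U).2 inferInstance
  let K0 : Submodule A Z := Submodule.span A (G : Set Z)
  have hUK0 : ∀ z ∈ W, z ∈ K → z ∈ K0 := by
    intro z hz hz'
    have h : z ∈ Submodule.span k (G : Set Z) := by rw [hG]; exact ⟨hz, hz'⟩
    exact Submodule.span_le_restrictScalars k A (G : Set Z) h
  have hK0K : K0 ≤ K := by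
    apply Submodule.span_le.2
    intro z hz
    have : z ∈ U := by rw [← hG]; exact Submodule.subset_span hz
    exact this.2
  have hVW : V ≤ W := le_sup_left
  have hCV : C ≤ V := le_sup_right
  let N : Submodule k Z := V ⊔ K0.restrictScalars k
  have hstab : ∀ x ∈ X, ∀ z ∈ N, x • z ∈ N := by
    intro x hx z hz
    obtain ⟨v, hv, y, hy, rfl⟩ := Submodule.mem_sup.1 hz
    rw [smul_add]
    refine N.add_mem ?_ (Submodule.mem_sup_right (K0.smul_mem _ hy))
    have hxv : x • v ∈ W :=
      Submodule.mem_sup_right ((Finset.le_sup (f := fun x => V.map (Algebra.lsmul k k Z x)) hx)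
        ⟨v, hv, rfl⟩)
    have : x • v ∈ (K.restrictScalars k) ⊔ C := by rw [hC.sup_eq_top]; trivial
    obtain ⟨κ, hκ, c, hc, h⟩ := Submodule.mem_sup.1 this
    rw [← h]
    refine N.add_mem (Submodule.mem_sup_right (hUK0 _ ?_ hκ)) (Submodule.mem_sup_left (hCV hc))
    have : κ = x • v - c := by rw [← h]; simp
    rw [this]
    exact W.sub_mem hxv (hVW (hCV hc))
  have hall : ∀ a : A, ∀ z ∈ N, a • z ∈ N := by
    intro a
    have ha : a ∈ Algebra.adjoin k (X : Set A) := by rw [hX]; trivial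
    induction ha using Algebra.adjoin_induction with
    | mem x hx => exact hstab x hx
    | algebraMap c => intro z hz; rw [algebraMap_smul]; exact N.smul_mem _ hz
    | add a b _ _ h1 h2 => intro z hz; rw [add_smul]; exact N.add_mem (h1 z hz) (h2 z hz)
    | mul a b _ _ h1 h2 => intro z hz; rw [mul_smul]; exact h1 _ (h2 z hz)
  let N' : Submodule A Z := { N with smul_mem' := fun a z hz => hall a z hz }
  have hN' : N' = ⊤ := by
    rw [eq_top_iff, ← hS, Submodule.span_le]
    intro s hs
    exact Submodule.mem_sup_left (Submodule.mem_sup_left (Submodule.subset_span hs))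
  refine ⟨G, le_antisymm hK0K ?_⟩
  intro κ hκ
  have : κ ∈ N' := by rw [hN']; trivial
  obtain ⟨v, hv, y, hy, rfl⟩ := Submodule.mem_sup.1 (this : κ ∈ N)
  refine K0.add_mem (hUK0 v (hVW hv) ?_) hy
  exact (Submodule.add_mem_iff_left K (hK0K hy)).1 hκ

/-- `R` as a right module over itself. -/
def opEquiv (R : Type*) [Ring R] : R ≃ₗ[Rᵐᵒᵖ] Rᵐᵒᵖ :=
  { MulOpposite.opAddEquiv with
    map_smul' := fun a x => by
      induction a using MulOpposite.rec'
      rfl }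

end OreAux

/-- (Ore-type condition, Schofield.) Let `R = k⟨x_0, …, x_n⟩` be the
free `k`-algebra on `n + 1` generators, let `X, Y, Z` be finitely generated projective
right `R`-modules, let `f : X → Y` be an injective right `R`-module map with
finite-dimensional (over `k`) cokernel, and let `g : Z → Y` be a right `R`-module map.
Then there are a finitely generated free right `R`-module `P = R^m`, an injective
right `R`-module map `f' : P → Z` with finite-dimensional cokernel, and a map
`g' : P → X` such that `g ∘ f' = f ∘ g'`. -/
theorem stmt18 (k : Type u) [Field k] (n : ℕ) (hn : 1 ≤ n)
    (X Y Z : Type u)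
    [AddCommGroup X] [Module (FreeAlgebra k (Fin (n + 1)))ᵐᵒᵖ X]
    [Module k X] [IsScalarTower k (FreeAlgebra k (Fin (n + 1)))ᵐᵒᵖ X]
    [AddCommGroup Y] [Module (FreeAlgebra k (Fin (n + 1)))ᵐᵒᵖ Y]
    [Module k Y] [IsScalarTower k (FreeAlgebra k (Fin (n + 1)))ᵐᵒᵖ Y]
    [AddCommGroup Z] [Module (FreeAlgebra k (Fin (n + 1)))ᵐᵒᵖ Z]
    [Module k Z] [IsScalarTower k (FreeAlgebra k (Fin (n + 1)))ᵐᵒᵖ Z]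
    (hXfin : Module.Finite (FreeAlgebra k (Fin (n + 1)))ᵐᵒᵖ X)
    (hXproj : Module.Projective (FreeAlgebra k (Fin (n + 1)))ᵐᵒᵖ X)
    (hYfin : Module.Finite (FreeAlgebra k (Fin (n + 1)))ᵐᵒᵖ Y)
    (hYproj : Module.Projective (FreeAlgebra k (Fin (n + 1)))ᵐᵒᵖ Y)
    (hZfin : Module.Finite (FreeAlgebra k (Fin (n + 1)))ᵐᵒᵖ Z)
    (hZproj : Module.Projective (FreeAlgebra k (Fin (n + 1)))ᵐᵒᵖ Z)
    (f : X →ₗ[(FreeAlgebra k (Fin (n + 1)))ᵐᵒᵖ] Y) (hf : Function.Injective f)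
    (hcoker : FiniteDimensional k (Y ⧸ LinearMap.range f))
    (g : Z →ₗ[(FreeAlgebra k (Fin (n + 1)))ᵐᵒᵖ] Y) :
    ∃ (m : ℕ)
      (f' : (Fin m → FreeAlgebra k (Fin (n + 1))) →ₗ[(FreeAlgebra k (Fin (n + 1)))ᵐᵒᵖ] Z)
      (g' : (Fin m → FreeAlgebra k (Fin (n + 1))) →ₗ[(FreeAlgebra k (Fin (n + 1)))ᵐᵒᵖ] X),
      Function.Injective f' ∧
      FiniteDimensional k (Z ⧸ LinearMap.range f') ∧
      g.comp f' = f.comp g' := by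
  let A := (FreeAlgebra k (Fin (n + 1)))ᵐᵒᵖ
  let K : Submodule (FreeAlgebra k (Fin (n + 1)))ᵐᵒᵖ Z := (LinearMap.range f).comap g
  have hKfin : FiniteDimensional k (Z ⧸ K) := by
    let q : (Z ⧸ K) →ₗ[(FreeAlgebra k (Fin (n + 1)))ᵐᵒᵖ] (Y ⧸ LinearMap.range f) :=
      Submodule.mapQ K (LinearMap.range f) g le_rfl
    have hq : Function.Injective q := by
      rw [← LinearMap.ker_eq_bot]
      exact Submodule.ker_liftQ_eq_bot _ _ _ (by simp [K, LinearMap.ker_comp])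
    exact FiniteDimensional.of_injective (q.restrictScalars k) hq
  have : Algebra.FiniteType k (FreeAlgebra k (Fin (n + 1)))ᵐᵒᵖ :=
    Algebra.FiniteType.equiv inferInstance (FreeAlgebra.starHom (R := k) (X := Fin (n + 1)))
  have hKfg : K.FG := OreAux.fg_of_cofinite (k := k) K hKfin
  have : Module.Finite (FreeAlgebra k (Fin (n + 1)))ᵐᵒᵖ K := Module.Finite.of_fg hKfg
  have hfree : Module.Free (FreeAlgebra k (Fin (n + 1)))ᵐᵒᵖ K := by
    obtain ⟨s, hs⟩ := hZproj.out
    have hsi : Function.Injective s := hs.injective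
    let β : Module.Basis (List (Fin (n + 1))) k (FreeAlgebra k (Fin (n + 1)))ᵐᵒᵖ :=
      (FreeAlgebra.basisFreeMonoid k (Fin (n + 1))).map
        (FreeAlgebra.starHom (R := k) (X := Fin (n + 1))).toLinearEquiv
    have hβ : ∀ u v, β (u ++ v) = β u * β v := by
      intro u v
      have h : ∀ a b : FreeMonoid (Fin (n + 1)), FreeAlgebra.basisFreeMonoid k (Fin (n + 1)) (a * b)
          = FreeAlgebra.basisFreeMonoid k (Fin (n + 1)) a *
            FreeAlgebra.basisFreeMonoid k (Fin (n + 1)) b := by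
        intro a b
        have h0 : ∀ a, FreeAlgebra.basisFreeMonoid k (Fin (n + 1)) a =
          FreeAlgebra.equivMonoidAlgebraFreeMonoid.symm (MonoidAlgebra.single a 1) := by
          intro a
          simp [FreeAlgebra.basisFreeMonoid]
        rw [h0, h0, h0, ← map_mul, MonoidAlgebra.single_mul_single, one_mul]
      have h2 := h (FreeMonoid.ofList u) (FreeMonoid.ofList v)
      change (FreeAlgebra.starHom (R := k) (X := Fin (n + 1))) (FreeAlgebra.basisFreeMonoid k (Fin (n + 1)) (FreeMonoid.ofList u * FreeMonoid.ofList v)) = _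
      rw [h2, map_mul]
      rfl
    have := OreAux.free_sub β hβ Z (K.map s)
    exact Module.Free.of_equiv (Submodule.equivMapOfInjective s hsi K).symm
  let b := Module.Free.chooseBasis (FreeAlgebra k (Fin (n + 1)))ᵐᵒᵖ K
  let m := Fintype.card (Module.Free.ChooseBasisIndex (FreeAlgebra k (Fin (n + 1)))ᵐᵒᵖ K)
  let e1 : K ≃ₗ[(FreeAlgebra k (Fin (n + 1)))ᵐᵒᵖ] (Fin m → (FreeAlgebra k (Fin (n + 1)))ᵐᵒᵖ) :=
    (b.reindex (Fintype.equivFin _)).equivFun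
  let e2 : (Fin m → FreeAlgebra k (Fin (n + 1))) ≃ₗ[(FreeAlgebra k (Fin (n + 1)))ᵐᵒᵖ] K :=
    (LinearEquiv.piCongrRight fun _ => OreAux.opEquiv _).trans e1.symm
  let f' := K.subtype.comp e2.toLinearMap
  have hmem : ∀ x, (g.comp f') x ∈ LinearMap.range f := fun x => (e2 x).2
  have hr : LinearMap.range f' = K := by
    simp [f', LinearMap.range_comp]
  refine ⟨m, f', (LinearEquiv.ofInjective f hf).symm.toLinearMap.comp
    ((g.comp f').codRestrict _ hmem), ?_, ?_, ?_⟩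
  · exact K.injective_subtype.comp e2.injective
  · rw [hr]; exact hKfin
  · refine LinearMap.ext fun x => ?_
    have := LinearEquiv.apply_symm_apply (LinearEquiv.ofInjective f hf)
      ((g.comp f').codRestrict _ hmem x)
    exact (congrArg Subtype.val this).symm
end
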